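/- arXiv:0907.0896 — 3 statements merged into one kernel-verified Lean document; each statement's English description precedes it below -/
import Mathlib

section
/- The module of logarithmic p-forms is dual to the module of logarithmic (ℓ-p)-forms: for a central essential arrangement A in C^ℓ with n hyperplanes and each 0 ≤ p ≤ ℓ, there is an isomorphism of graded R-modules Hom_R(Ω^p(A), R) ≅ Ω^{ℓ-p}(A)(ℓ-n), induced by the exterior multiplication pairing Ω^p(A) ⊗_R Ω^{ℓ-p}(A) → Ω^ℓ(A) ≅ R(n-ℓ). -/
open MvPolynomial Finset

/-- Wedge (interior coefficient formula) of a 1-form with coordinates `v` against a form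
given by its coefficient function `μ` on index sets: `(v ∧ μ)_T = ∑_{j∈T} ± v_j μ_{T∖j}`. -/
noncomputable def wedge1 {ℓ : ℕ} {A : Type*} [CommRing A] (v : Fin ℓ → A)
    (μ : Finset (Fin ℓ) → A) (T : Finset (Fin ℓ)) : A :=
  ∑ j ∈ T, (-1 : A) ^ ((T.filter (· < j)).card) * v j * μ (T.erase j)

lemma wedge1_add {ℓ : ℕ} {A : Type*} [CommRing A] (v : Fin ℓ → A) (a b : Finset (Fin ℓ) → A)
    (T : Finset (Fin ℓ)) : wedge1 v (a + b) T = wedge1 v a T + wedge1 v b T := by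
  simp [wedge1, mul_add, Finset.sum_add_distrib]

lemma wedge1_smul {ℓ : ℕ} {A : Type*} [CommRing A] (v : Fin ℓ → A) (r : A)
    (a : Finset (Fin ℓ) → A) (T : Finset (Fin ℓ)) : wedge1 v (r • a) T = r * wedge1 v a T := by
  simp only [wedge1, Pi.smul_apply, smul_eq_mul, Finset.mul_sum]
  exact Finset.sum_congr rfl (fun j _ => by ring)

/-- Wedge product of a `p`-form `μ` with a form `ν` (coefficient functions on index sets):
`(μ ∧ ν)_T = ∑_{B ⊆ T, |B| = p} ± μ_B ν_{T∖B}`, with the shuffle sign. -/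
noncomputable def wedgeP {ℓ : ℕ} {A : Type*} [CommRing A] (p : ℕ)
    (μ ν : Finset (Fin ℓ) → A) (T : Finset (Fin ℓ)) : A :=
  ∑ B ∈ T.powersetCard p,
    (-1 : A) ^ (∑ b ∈ B, ((T \ B).filter (· < b)).card) * μ B * ν (T \ B)

/-- The module of (numerators of) logarithmic `p`-forms of the arrangement with defining
polynomial `Q`: a form `η ∈ Ω^p(A)` is written `η = μ/Q` with `μ` a polynomial `p`-form,
and the condition `Q·dη` regular is equivalent to `Q ∣ (dQ ∧ μ)` coefficientwise.
(The grading: `η` has total degree `m` iff each `μ_T` is homogeneous of degree `m+n-p`.) -/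
noncomputable def logForms (ℓ : ℕ) (Q : MvPolynomial (Fin ℓ) ℂ) (p : ℕ) :
    Submodule (MvPolynomial (Fin ℓ) ℂ) (Finset (Fin ℓ) → MvPolynomial (Fin ℓ) ℂ) where
  carrier := {μ | (∀ T, T.card ≠ p → μ T = 0) ∧
    ∀ T, Q ∣ wedge1 (fun j => pderiv j Q) μ T}
  add_mem' := by
    rintro a b ⟨ha1, ha2⟩ ⟨hb1, hb2⟩
    refine ⟨fun T hT => by simp [Pi.add_apply, ha1 T hT, hb1 T hT], fun T => ?_⟩
    rw [wedge1_add]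
    exact dvd_add (ha2 T) (hb2 T)
  zero_mem' := ⟨fun _ _ => rfl, fun T => by simp [wedge1]⟩
  smul_mem' := by
    rintro r a ⟨ha1, ha2⟩
    refine ⟨fun T hT => by simp [ha1 T hT], fun T => ?_⟩
    rw [wedge1_smul]
    exact Dvd.dvd.mul_left (ha2 T) r


namespace LF
variable {ℓ : ℕ} {A : Type*} [CommRing A]

/-- sign exponent -/
def ex (B : Finset (Fin ℓ)) : ℕ := ∑ b ∈ B, ((univ \ B).filter (· < b)).card

def lt (B : Finset (Fin ℓ)) (j : Fin ℓ) : ℕ := (B.filter (· < j)).card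

lemma lt_erase (B : Finset (Fin ℓ)) (j k : Fin ℓ) (hj : j ∈ B) :
    lt B k = lt (B.erase j) k + if j < k then 1 else 0 := by
  unfold lt
  conv_lhs => rw [← Finset.insert_erase hj, Finset.filter_insert]
  split_ifs with h
  · rw [Finset.card_insert_of_notMem (by simp)]
  · simp

lemma lt_insert (B : Finset (Fin ℓ)) (j k : Fin ℓ) (hj : j ∉ B) :
    lt (insert j B) k = lt B k + if j < k then 1 else 0 := by
  rw [lt_erase _ j k (mem_insert_self _ _), erase_insert hj]

lemma sgn_eq {a b : ℕ} (h : Even (a + b)) : (-1 : A) ^ a = (-1) ^ b := by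
  rcases Nat.even_or_odd a with ha | ha
  · rw [ha.neg_one_pow, ((Nat.even_add.1 h).1 ha).neg_one_pow]
  · have hb : Odd b := by
      rw [← Nat.not_even_iff_odd] at ha ⊢
      exact fun hb => ha ((Nat.even_add.1 h).2 hb)
    rw [ha.neg_one_pow, hb.neg_one_pow]

lemma sgn_neg {a b : ℕ} (h : Odd (a + b)) : (-1 : A) ^ a = - (-1) ^ b := by
  have := sgn_eq (A := A) (a := a) (b := b + 1) (by rw [← add_assoc]; exact h.add_one)
  rw [this]; ring

lemma ex_insert (S : Finset (Fin ℓ)) (j : Fin ℓ) (hj : j ∉ S) :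
    ex (insert j S) + (S.card - lt S j) = ex S + lt (univ \ S) j := by
  unfold ex
  have hU : univ \ S = insert j (univ \ insert j S) := by
    ext x; by_cases h : x = j <;> simp [h, hj]
  have hjj : j ∉ univ \ insert j S := by simp
  rw [Finset.sum_insert hj]
  have h1 : ∀ b ∈ S, ((univ \ S).filter (· < b)).card =
      ((univ \ insert j S).filter (· < b)).card + if j < b then 1 else 0 := by
    intro b _
    have := lt_insert (univ \ insert j S) j b hjj
    rw [← hU] at this
    exact this
  rw [Finset.sum_congr rfl h1, Finset.sum_add_distrib]
  have h2 : ∑ b ∈ S, (if j < b then 1 else 0) = S.card - lt S j := by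
    rw [← Finset.card_filter]
    have := Finset.card_filter_add_card_filter_not (s := S) (fun b => b < j)
    have h3 : S.filter (fun b => ¬ b < j) = S.filter (fun b => j < b) := by
      apply Finset.filter_congr
      intro b hb
      have : b ≠ j := fun h => hj (h ▸ hb)
      omega
    rw [h3] at this
    unfold lt
    omega
  have h4 : lt (univ \ S) j = ((univ \ insert j S).filter (· < j)).card := by
    rw [hU, lt_insert _ _ _ hjj]; simp [lt]
  rw [h2, h4]; ring

lemma adj (p : ℕ) (v : Fin ℓ → A) (α ν : Finset (Fin ℓ) → A) :
    wedgeP (p + 1) (wedge1 v α) ν univ = (-1) ^ p * wedgeP p α (wedge1 v ν) univ := by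
  unfold wedgeP wedge1
  simp only [Finset.mul_sum, Finset.sum_mul]
  rw [Finset.sum_sigma', Finset.sum_sigma']
  refine Finset.sum_bij' (fun x _ => ⟨x.1.erase x.2, x.2⟩) (fun x _ => ⟨insert x.2 x.1, x.2⟩)
    ?_ ?_ ?_ ?_ ?_
  · rintro ⟨B, j⟩ h
    simp only [mem_sigma, mem_powersetCard_univ] at h
    simp [h.2, h.1, card_erase_of_mem]
  · rintro ⟨B, j⟩ h
    simp only [mem_sigma, mem_powersetCard_univ, mem_sdiff, mem_univ, true_and] at h
    simp [h.2, h.1, card_insert_of_notMem]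
  · rintro ⟨B, j⟩ h
    simp only [mem_sigma, mem_powersetCard_univ] at h
    simp [h.2]
  · rintro ⟨B, j⟩ h
    simp only [mem_sigma, mem_powersetCard_univ, mem_sdiff, mem_univ, true_and] at h
    simp [h.2]
  · rintro ⟨B, j⟩ h
    simp only [mem_sigma, mem_powersetCard_univ] at h
    obtain ⟨hB, hj⟩ := h
    obtain ⟨S, hS, rfl⟩ : ∃ S, j ∉ S ∧ B = insert j S := ⟨B.erase j, by simp, by simp [hj]⟩
    simp only [erase_insert hS]
    have hc : S.card = p := by rw [card_insert_of_notMem hS] at hB; omega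
    have e1 : (univ \ S).erase j = univ \ insert j S := by
      ext x; simp
    rw [e1]
    have h1 := ex_insert S j hS
    have h2 : lt (insert j S) j = lt S j := by rw [lt_insert _ _ _ hS]; simp
    have h3 : lt S j ≤ S.card := card_le_card (filter_subset _ _)
    have key : (-1 : A) ^ ex (insert j S) * (-1) ^ lt (insert j S) j =
        (-1) ^ p * ((-1) ^ ex S * (-1) ^ lt (univ \ S) j) := by
      rw [← pow_add, ← pow_add, ← pow_add]
      apply sgn_eq
      rw [h2, ← h1, hc, Nat.even_iff]
      omega
    unfold ex lt at key
    linear_combination (v j * α S * ν (univ \ insert j S)) * key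

/-- contraction -/
def contr (j : Fin ℓ) (μ : Finset (Fin ℓ) → A) (T : Finset (Fin ℓ)) : A :=
  if j ∈ T then 0 else (-1) ^ lt T j * μ (insert j T)

lemma cartan (v : Fin ℓ → A) (μ : Finset (Fin ℓ) → A) (j : Fin ℓ) (T : Finset (Fin ℓ)) :
    v j * μ T = contr j (wedge1 v μ) T + wedge1 v (contr j μ) T := by
  by_cases hj : j ∈ T
  · unfold wedge1
    rw [Finset.sum_eq_single_of_mem j hj]
    · simp only [contr, hj, if_true, notMem_erase, if_false, insert_erase hj]
      have h : lt T j = lt (T.erase j) j := by rw [lt_erase T j j hj]; simp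
      have : (-1 : A) ^ lt T j * (-1) ^ lt (T.erase j) j = 1 := by
        rw [← h, ← pow_add]; exact (Even.add_self _).neg_one_pow
      change _ = 0 + (-1 : A) ^ lt T j * v j * _
      linear_combination (-(v j * μ T)) * this
    · intro k _ hk
      simp [contr, hj, hk.symm]
  · simp only [contr, hj, if_false]
    unfold wedge1
    rw [Finset.sum_insert hj, mul_add, erase_insert hj, Finset.mul_sum, add_assoc,
      ← Finset.sum_add_distrib, Finset.sum_eq_zero]
    · have h : lt (insert j T) j = lt T j := by rw [lt_insert _ _ _ hj]; simp
      have : (-1 : A) ^ lt T j * (-1) ^ lt (insert j T) j = 1 := by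
        rw [h, ← pow_add]; exact (Even.add_self _).neg_one_pow
      change _ = (-1 : A) ^ lt T j * ((-1) ^ lt (insert j T) j * _ * _) + 0
      linear_combination (-(v j * μ T)) * this
    · intro k hk
      have hkj : k ≠ j := fun h => hj (h ▸ hk)
      have h1 : j ∉ T.erase k := fun h => hj (mem_of_mem_erase h)
      rw [contr, if_neg h1, erase_insert_of_ne hkj.symm]
      have key : (-1 : A) ^ lt T j * (-1) ^ lt (insert j T) k =
          - ((-1) ^ lt T k * (-1) ^ lt (T.erase k) j) := by
        rw [← pow_add, ← pow_add]
        apply sgn_neg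
        rw [lt_insert _ _ _ hj, lt_erase T k j hk, Nat.odd_iff]
        split_ifs <;> omega
      change (-1 : A) ^ lt T j * ((-1) ^ lt (insert j T) k * _ * _) +
        (-1) ^ lt T k * _ * ((-1) ^ lt (T.erase k) j * _) = 0
      linear_combination (v k * μ (insert j (T.erase k))) * key

lemma wedge_sq (v : Fin ℓ → A) (μ : Finset (Fin ℓ) → A) (T : Finset (Fin ℓ)) :
    wedge1 v (wedge1 v μ) T = 0 := by
  unfold wedge1
  simp only [Finset.mul_sum]
  rw [Finset.sum_sigma']
  refine Finset.sum_involution (fun x _ => ⟨x.2, x.1⟩) ?_ ?_ ?_ ?_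
  · rintro ⟨j, k⟩ h
    simp only [mem_sigma, mem_erase] at h
    obtain ⟨hj, hkj, hk⟩ := h
    have key : (-1 : A) ^ lt T j * (-1) ^ lt (T.erase j) k =
          - ((-1) ^ lt T k * (-1) ^ lt (T.erase k) j) := by
      rw [← pow_add, ← pow_add]
      apply sgn_neg
      rw [lt_erase T k j hk, lt_erase T j k hj, Nat.odd_iff]
      split_ifs <;> omega
    simp only [erase_right_comm (a := k) (b := j)]
    change (-1 : A) ^ lt T j * _ * ((-1) ^ lt (T.erase j) k * _ * _) +
        (-1) ^ lt T k * _ * ((-1) ^ lt (T.erase k) j * _ * _) = 0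
    linear_combination (v k * v j * μ ((T.erase j).erase k)) * key
  · rintro ⟨j, k⟩ h _ h2
    simp only [mem_sigma, mem_erase] at h
    simp only [Sigma.mk.injEq] at h2
    exact h.2.1 h2.1
  · rintro ⟨j, k⟩ h
    simp only [mem_sigma, mem_erase] at h ⊢
    exact ⟨h.2.2, h.2.1.symm, h.1⟩
  · rintro ⟨j, k⟩ h; rfl

lemma wedgeP_dvd_left {f : A} (p : ℕ) (μ ν : Finset (Fin ℓ) → A) (T : Finset (Fin ℓ))
    (h : ∀ B, f ∣ μ B) : f ∣ wedgeP p μ ν T :=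
  Finset.dvd_sum fun B _ => Dvd.dvd.mul_right (Dvd.dvd.mul_left (h B) _) _

lemma wedgeP_dvd_right {f : A} (p : ℕ) (μ ν : Finset (Fin ℓ) → A) (T : Finset (Fin ℓ))
    (h : ∀ B, f ∣ ν B) : f ∣ wedgeP p μ ν T :=
  Finset.dvd_sum fun B _ => Dvd.dvd.mul_left (h _) _

lemma wedgeP_add_left (p : ℕ) (μ μ' ν : Finset (Fin ℓ) → A) (T : Finset (Fin ℓ)) :
    wedgeP p (μ + μ') ν T = wedgeP p μ ν T + wedgeP p μ' ν T := by
  simp [wedgeP, mul_add, add_mul, Finset.sum_add_distrib]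

lemma wedgeP_add_right (p : ℕ) (μ ν ν' : Finset (Fin ℓ) → A) (T : Finset (Fin ℓ)) :
    wedgeP p μ (ν + ν') T = wedgeP p μ ν T + wedgeP p μ ν' T := by
  simp [wedgeP, mul_add, Finset.sum_add_distrib]

lemma wedgeP_smul_left (p : ℕ) (r : A) (μ ν : Finset (Fin ℓ) → A) (T : Finset (Fin ℓ)) :
    wedgeP p (r • μ) ν T = r * wedgeP p μ ν T := by
  simp only [wedgeP, Pi.smul_apply, smul_eq_mul, Finset.mul_sum]
  exact Finset.sum_congr rfl (fun j _ => by ring)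

lemma wedgeP_smul_right (p : ℕ) (r : A) (μ ν : Finset (Fin ℓ) → A) (T : Finset (Fin ℓ)) :
    wedgeP p μ (r • ν) T = r * wedgeP p μ ν T := by
  simp only [wedgeP, Pi.smul_apply, smul_eq_mul, Finset.mul_sum]
  exact Finset.sum_congr rfl (fun j _ => by ring)

lemma wedgeP_single (p : ℕ) (S : Finset (Fin ℓ)) (hS : S.card = p) (ν : Finset (Fin ℓ) → A) :
    wedgeP p (Pi.single S 1) ν univ = (-1) ^ ex S * ν (univ \ S) := by
  unfold wedgeP
  rw [Finset.sum_eq_single_of_mem S (by simp [hS])]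
  · simp [ex]
  · intro B _ hB
    simp [hB]

/-- the local pairing divisibility -/
lemma pair_dvd {f : A} (p : ℕ) (v : Fin ℓ → A) (j : Fin ℓ) (hj : IsUnit (v j))
    (μ ν : Finset (Fin ℓ) → A) (h0 : ∀ T, T.card ≠ p → μ T = 0) (hμ : ∀ T, f ∣ wedge1 v μ T)
    (hν : ∀ T, f ∣ wedge1 v ν T) : f ∣ wedgeP p μ ν univ := by
  rw [← hj.dvd_mul_left, ← wedgeP_smul_left]
  have e : v j • μ = contr j (wedge1 v μ) + wedge1 v (contr j μ) := by
    ext T; simpa using cartan v μ j T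
  rw [e, wedgeP_add_left]
  refine dvd_add (wedgeP_dvd_left _ _ _ _ ?_) ?_
  · intro B
    unfold contr
    split_ifs
    · exact dvd_zero _
    · exact Dvd.dvd.mul_left (hμ _) _
  · cases p with
    | zero =>
      have : wedgeP 0 (wedge1 v (contr j μ)) ν univ = 0 := by
        simp [wedgeP, wedge1]
      rw [this]; exact dvd_zero _
    | succ p =>
      rw [adj]
      exact Dvd.dvd.mul_left (wedgeP_dvd_right _ _ _ _ hν) _

end LF

namespace LF
variable {ℓ : ℕ}

noncomputable def lin (a : Fin ℓ → ℂ) : MvPolynomial (Fin ℓ) ℂ := ∑ j, C (a j) * X j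

lemma lin_eq (a : Fin ℓ → ℂ) : lin a = sumSMulX (Finsupp.equivFunOnFinite.symm a) := by
  rw [sumSMulX, Finsupp.linearCombination_apply, Finsupp.sum_fintype _ _ (by simp), lin]
  simp [MvPolynomial.smul_eq_C_mul]

lemma coeff_lin (a : Fin ℓ → ℂ) (j : Fin ℓ) : (lin a).coeff (Finsupp.single j 1) = a j := by
  rw [lin_eq, coeff_sumSMulX]; rfl

lemma lin_irr (a : Fin ℓ → ℂ) (ha : a ≠ 0) : Irreducible (lin a) := by
  obtain ⟨j, hj⟩ := Function.ne_iff.1 ha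
  rw [lin_eq]
  apply irreducible_sumSMulX
  · exact ⟨j, by simpa using hj⟩
  · intro r hr
    refine isUnit_iff_ne_zero.2 fun h => hj ?_
    have := hr j
    rw [h, zero_dvd_iff] at this
    exact this

lemma lin_rel (a b : Fin ℓ → ℂ) (ha : a ≠ 0) (hb : b ≠ 0) (h : ∀ t : ℂ, b ≠ t • a) :
    IsRelPrime (lin a) (lin b) := by
  rw [(lin_irr a ha).isRelPrime_iff_not_dvd]
  intro hd
  obtain ⟨u, hu⟩ := (lin_irr a ha).associated_of_dvd (lin_irr b hb) hd
  obtain ⟨t, ht, hC⟩ := MvPolynomial.isUnit_iff_eq_C_of_isReduced.1 u.isUnit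
  apply h t
  ext j
  have := congrArg (coeff (Finsupp.single j 1)) hu
  rw [hC, mul_comm, coeff_C_mul, coeff_lin, coeff_lin] at this
  rw [← this, Pi.smul_apply, smul_eq_mul]

lemma pderiv_lin (a : Fin ℓ → ℂ) (j : Fin ℓ) : pderiv j (lin a) = C (a j) := by
  simp [lin, pderiv_X, Pi.single_apply]

lemma pderiv_prod {n : ℕ} (s : Finset (Fin n)) (f : Fin n → MvPolynomial (Fin ℓ) ℂ) (j : Fin ℓ) :
    pderiv j (∏ i ∈ s, f i) = ∑ i ∈ s, (∏ k ∈ s.erase i, f k) * pderiv j (f i) := by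
  induction s using Finset.induction_on with
  | empty => simp
  | insert a s ha ih =>
    rw [prod_insert ha, Derivation.leibniz, ih, sum_insert ha, erase_insert ha, add_comm,
      smul_eq_mul, smul_eq_mul, Finset.mul_sum]
    congr 1
    refine sum_congr rfl fun i hi => ?_
    have : a ≠ i := fun h => ha (h ▸ hi)
    rw [erase_insert_of_ne this, prod_insert (fun h => ha (mem_of_mem_erase h))]
    ring

lemma wedge1_sum {n : ℕ} {A : Type*} [CommRing A] (g : Fin n → A) (v : Fin n → Fin ℓ → A)
    (μ : Finset (Fin ℓ) → A) (T : Finset (Fin ℓ)) :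
    wedge1 (fun j => ∑ i, g i * v i j) μ T = ∑ i, g i * wedge1 (v i) μ T := by
  simp only [wedge1, Finset.mul_sum, Finset.sum_mul]
  rw [Finset.sum_comm]
  exact sum_congr rfl fun i _ => sum_congr rfl fun j _ => by ring

lemma qe_mem (Q : MvPolynomial (Fin ℓ) ℂ) (p : ℕ) (S : Finset (Fin ℓ)) :
    (if S.card = p then Q • Pi.single S 1 else 0) ∈ logForms ℓ Q p := by
  split_ifs with h
  · refine ⟨fun T hT => ?_, fun T => ?_⟩
    · have : T ≠ S := fun e => hT (e ▸ h)
      simp [this]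
    · rw [wedge1_smul]; exact dvd_mul_right _ _
  · exact Submodule.zero_mem _

noncomputable def qe (Q : MvPolynomial (Fin ℓ) ℂ) (p : ℕ) (S : Finset (Fin ℓ)) :
    logForms ℓ Q p := ⟨_, qe_mem Q p S⟩

lemma qe_apply (Q : MvPolynomial (Fin ℓ) ℂ) (p : ℕ) (S : Finset (Fin ℓ)) (h : S.card = p)
    (T : Finset (Fin ℓ)) : (qe Q p S).1 T = if T = S then Q else 0 := by
  simp only [qe, if_pos h, Pi.smul_apply, Pi.single_apply, smul_eq_mul, mul_ite, mul_one, mul_zero]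

lemma qe_zero (Q : MvPolynomial (Fin ℓ) ℂ) (p : ℕ) (S : Finset (Fin ℓ)) (h : S.card ≠ p) :
    qe Q p S = 0 := by
  apply Subtype.ext
  simp only [qe, if_neg h]
  rfl

lemma Q_smul (Q : MvPolynomial (Fin ℓ) ℂ) (p : ℕ) (μ : logForms ℓ Q p) :
    Q • μ = ∑ S ∈ univ.powersetCard p, μ.1 S • qe Q p S := by
  apply Subtype.ext
  rw [Submodule.coe_smul, Submodule.coe_sum]
  ext1 T
  rw [Finset.sum_apply, Pi.smul_apply, smul_eq_mul]
  have : ∀ S ∈ univ.powersetCard p, ((μ.1 S • qe Q p S : logForms ℓ Q p) :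
      Finset (Fin ℓ) → MvPolynomial (Fin ℓ) ℂ) T = if T = S then μ.1 S * Q else 0 := by
    intro S hS
    rw [Submodule.coe_smul, Pi.smul_apply, qe_apply _ _ _ (mem_powersetCard_univ.1 hS),
      smul_eq_mul, mul_ite, mul_zero]
  rw [Finset.sum_congr rfl this, Finset.sum_ite_eq]
  split_ifs with h
  · exact mul_comm _ _
  · rw [μ.2.1 T (fun e => h (mem_powersetCard_univ.2 e)), mul_zero]

lemma surj_key (Q : MvPolynomial (Fin ℓ) ℂ) (p : ℕ) (hp : p ≤ ℓ)
    (φ : Module.Dual (MvPolynomial (Fin ℓ) ℂ) (logForms ℓ Q p)) :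
    ∃ ν : Finset (Fin ℓ) → MvPolynomial (Fin ℓ) ℂ, (∀ T, T.card ≠ ℓ - p → ν T = 0) ∧
      ∀ μ : logForms ℓ Q p,
      wedgeP p (μ : Finset (Fin ℓ) → MvPolynomial (Fin ℓ) ℂ) ν univ = Q * φ μ := by
  refine ⟨fun T => (-1) ^ ex (univ \ T) * φ (qe Q p (univ \ T)), fun T hT => ?_, fun μ => ?_⟩
  · have h1 : (univ \ T).card ≠ p := by
      have h2 := card_sdiff_add_card_eq_card (subset_univ T)
      rw [card_univ, Fintype.card_fin] at h2
      omega
    simp only [qe_zero Q p _ h1, map_zero, mul_zero]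
  · rw [← smul_eq_mul, ← map_smul, Q_smul, map_sum]
    refine sum_congr rfl fun S _ => ?_
    have : univ \ (univ \ S) = S := by simp
    simp only [this, map_smul, smul_eq_mul]
    have h1 : (-1 : MvPolynomial (Fin ℓ) ℂ) ^ ex S * (-1) ^ ex S = 1 := by
      rw [← pow_add]; exact (Even.add_self _).neg_one_pow
    change (-1) ^ ex S * _ * _ = _
    linear_combination (μ.1 S * φ (qe Q p S)) * h1

section
variable {n : ℕ} (c : Fin n → Fin ℓ → ℂ) (hnz : ∀ i, c i ≠ 0)
    (hprop : ∀ i k, i ≠ k → ∀ t : ℂ, c i ≠ t • c k)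
include hnz hprop

lemma rel (i k : Fin n) (h : i ≠ k) : IsRelPrime (lin (c i)) (lin (c k)) :=
  lin_rel _ _ (hnz i) (hnz k) (hprop k i h.symm)

lemma Q_dvd (x : MvPolynomial (Fin ℓ) ℂ) (h : ∀ i, lin (c i) ∣ x) : (∏ i, lin (c i)) ∣ x :=
  Fintype.prod_dvd_of_isRelPrime (fun i k hik => rel c hnz hprop i k hik) h

lemma log_iff (μ : Finset (Fin ℓ) → MvPolynomial (Fin ℓ) ℂ) (T : Finset (Fin ℓ)) :
    (∏ i, lin (c i)) ∣ wedge1 (fun j => pderiv j (∏ i, lin (c i))) μ T ↔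
      ∀ i, lin (c i) ∣ wedge1 (fun j => C (c i j)) μ T := by
  have e : (fun j => pderiv j (∏ i, lin (c i))) =
      fun j => ∑ i, (∏ k ∈ univ.erase i, lin (c k)) * C (c i j) := by
    ext1 j
    rw [pderiv_prod]
    simp only [pderiv_lin]
  rw [e, wedge1_sum _ (fun i j => C (c i j))]
  constructor
  · intro h i
    have h1 := (dvd_prod_of_mem (fun i => lin (c i)) (mem_univ i)).trans h
    rw [← Finset.add_sum_erase _ _ (mem_univ i)] at h1
    have h2 := (dvd_add_left (Finset.dvd_sum fun k hk => ?_)).1 h1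
    · refine IsRelPrime.dvd_of_dvd_mul_left ?_ h2
      exact IsRelPrime.prod_right fun k hk => rel c hnz hprop i k (ne_of_mem_erase hk).symm
    · apply Dvd.dvd.mul_right
      exact dvd_prod_of_mem (fun i => lin (c i))
        (mem_erase.2 ⟨(ne_of_mem_erase hk).symm, mem_univ i⟩)
  · intro h
    refine Finset.dvd_sum fun i _ => ?_
    rw [← Finset.mul_prod_erase _ _ (mem_univ i), mul_comm]
    exact mul_dvd_mul_left _ (h i)

lemma mem_log (p : ℕ) (μ : Finset (Fin ℓ) → MvPolynomial (Fin ℓ) ℂ) :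
    μ ∈ logForms ℓ (∏ i, lin (c i)) p ↔ (∀ T, T.card ≠ p → μ T = 0) ∧
      ∀ i T, lin (c i) ∣ wedge1 (fun j => C (c i j)) μ T := by
  change (_ ∧ _) ↔ _
  rw [forall_comm]
  simp only [log_iff c hnz hprop]

lemma pair_Q (p q : ℕ) (μ ν : Finset (Fin ℓ) → MvPolynomial (Fin ℓ) ℂ)
    (hμ : μ ∈ logForms ℓ (∏ i, lin (c i)) p) (hν : ν ∈ logForms ℓ (∏ i, lin (c i)) q) :
    (∏ i, lin (c i)) ∣ wedgeP p μ ν univ := by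
  rw [mem_log c hnz hprop] at hμ hν
  refine Q_dvd c hnz hprop _ fun i => ?_
  obtain ⟨j, hj⟩ := Function.ne_iff.1 (hnz i)
  exact pair_dvd p (fun j => C (c i j)) j ((isUnit_iff_ne_zero.2 hj).map C) μ ν hμ.1
    (hμ.2 i) (hν.2 i)

lemma test_mem (p : ℕ) (S : Finset (Fin ℓ)) (hS : S.card = p) (i : Fin n) :
    ((∏ k ∈ univ.erase i, lin (c k)) • wedge1 (fun j => C (c i j)) (Pi.single S 1)) ∈
      logForms ℓ (∏ i, lin (c i)) (p + 1) := by
  rw [mem_log c hnz hprop]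
  refine ⟨fun T hT => ?_, fun k T => ?_⟩
  · rw [Pi.smul_apply]
    convert smul_zero _
    refine Finset.sum_eq_zero fun j hj => ?_
    have : T.erase j ≠ S := by
      intro e
      rw [← e, card_erase_of_mem hj] at hS
      have := card_pos.2 ⟨j, hj⟩
      omega
    simp [this]
  · rw [wedge1_smul]
    by_cases h : k = i
    · subst h
      rw [wedge_sq, mul_zero]; exact dvd_zero _
    · exact Dvd.dvd.mul_right (dvd_prod_of_mem (fun i => lin (c i))
        (mem_erase.2 ⟨h, mem_univ k⟩)) _

lemma Q_ne : (∏ i, lin (c i)) ≠ 0 := prod_ne_zero_iff.2 fun i _ => (lin_irr _ (hnz i)).ne_zero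

lemma surj (p : ℕ) (hp : p ≤ ℓ)
    (φ : Module.Dual (MvPolynomial (Fin ℓ) ℂ) (logForms ℓ (∏ i, lin (c i)) p)) :
    ∃ ν ∈ logForms ℓ (∏ i, lin (c i)) (ℓ - p), ∀ μ : logForms ℓ (∏ i, lin (c i)) p,
      wedgeP p (μ : Finset (Fin ℓ) → MvPolynomial (Fin ℓ) ℂ) ν univ =
        (∏ i, lin (c i)) * φ μ := by
  obtain ⟨ν, h0, key⟩ := surj_key _ p hp φ
  refine ⟨ν, ?_, key⟩
  rw [mem_log c hnz hprop]
  refine ⟨h0, fun i T => ?_⟩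
  by_cases hT : T.card = ℓ - p + 1
  · have h2 := card_sdiff_add_card_eq_card (subset_univ T)
    rw [card_univ, Fintype.card_fin] at h2
    obtain ⟨r, rfl⟩ : ∃ r, p = r + 1 := ⟨p - 1, by omega⟩
    have hS : (univ \ T).card = r := by omega
    obtain ⟨x, hk⟩ : ∃ x, wedgeP (r + 1) ((∏ k ∈ univ.erase i, lin (c k)) •
        wedge1 (fun j => C (c i j)) (Pi.single (univ \ T) 1)) ν univ = (∏ i, lin (c i)) * x :=
      ⟨_, key ⟨_, test_mem c hnz hprop r (univ \ T) hS i⟩⟩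
    have hg : (∏ k ∈ univ.erase i, lin (c k)) ≠ 0 :=
      prod_ne_zero_iff.2 fun i _ => (lin_irr _ (hnz i)).ne_zero
    have hm := Finset.mul_prod_erase univ (fun i => lin (c i)) (mem_univ i)
    rw [wedgeP_smul_left, adj, wedgeP_single _ _ hS, ← hm, mul_comm (lin (c i)),
      mul_assoc (∏ k ∈ univ.erase i, lin (c k))] at hk
    have hk := mul_left_cancel₀ hg hk
    have e : univ \ (univ \ T) = T := by simp
    rw [e, ← mul_assoc, ← pow_add] at hk
    have hd := Dvd.intro _ hk.symm
    exact (((isUnit_one.neg).pow _).dvd_mul_left).1 hd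
  · have : wedge1 (fun j => C (c i j)) ν T = 0 := by
      refine Finset.sum_eq_zero fun j hj => ?_
      rw [h0, mul_zero]
      rw [card_erase_of_mem hj]
      have := card_pos.2 ⟨j, hj⟩
      omega
    rw [this]; exact dvd_zero _

lemma inj (p : ℕ) (hp : p ≤ ℓ) (ν : Finset (Fin ℓ) → MvPolynomial (Fin ℓ) ℂ)
    (hν : ν ∈ logForms ℓ (∏ i, lin (c i)) (ℓ - p))
    (h : ∀ μ : logForms ℓ (∏ i, lin (c i)) p,
      wedgeP p (μ : Finset (Fin ℓ) → MvPolynomial (Fin ℓ) ℂ) ν univ = 0) : ν = 0 := by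
  ext1 T
  by_cases hT : T.card = ℓ - p
  · have h2 := card_sdiff_add_card_eq_card (subset_univ T)
    rw [card_univ, Fintype.card_fin] at h2
    have hS : (univ \ T).card = p := by omega
    have := h ⟨_, qe_mem _ p (univ \ T)⟩
    simp only [if_pos hS] at this
    rw [wedgeP_smul_left, wedgeP_single _ _ hS] at this
    have e : univ \ (univ \ T) = T := by simp
    rw [e] at this
    have := (mul_eq_zero.1 this).resolve_left (Q_ne c hnz hprop)
    exact (mul_eq_zero.1 this).resolve_left (pow_ne_zero _ (by simp))
  · exact hν.1 T hT

end
end LF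

/-!
STATEMENT 0: For a central essential arrangement `A` of `n` hyperplanes in `ℂ^ℓ` with
defining polynomial `Q = ∏ f_i` and each `0 ≤ p ≤ ℓ`, the module of logarithmic `p`-forms
is dual to the module of logarithmic `(ℓ-p)`-forms: there is an isomorphism of (graded)
`R`-modules `Hom_R(Ω^p(A), R) ≅ Ω^{ℓ-p}(A)(ℓ-n)`, induced by exterior multiplication
`Ω^p(A) ⊗ Ω^{ℓ-p}(A) → Ω^ℓ(A) ≅ R(n-ℓ)`.  In terms of numerators (`η = μ/Q`), the top
coefficient of `μ ∧ ν` is divisible by `Q` and the pairing is `(μ, ν) ↦ (μ ∧ ν)_[ℓ] / Q`.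
-/
theorem logarithmic_forms_self_dual
    (ℓ n : ℕ) (c : Fin n → Fin ℓ → ℂ)
    (hnz : ∀ i, c i ≠ 0)
    (hprop : ∀ i k, i ≠ k → ∀ t : ℂ, c i ≠ t • c k)
    (hess : Submodule.span ℂ (Set.range c) = ⊤)
    (Q : MvPolynomial (Fin ℓ) ℂ) (hQ : Q = ∏ i, ∑ j, C (c i j) * X j)
    (p : ℕ) (hp : p ≤ ℓ) :
    ∃ Φ : logForms ℓ Q (ℓ - p) ≃ₗ[MvPolynomial (Fin ℓ) ℂ]
        Module.Dual (MvPolynomial (Fin ℓ) ℂ) (logForms ℓ Q p),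
      ∀ (ν : logForms ℓ Q (ℓ - p)) (μ : logForms ℓ Q p),
        Q * Φ ν μ = wedgeP p (μ : Finset (Fin ℓ) → MvPolynomial (Fin ℓ) ℂ)
          (ν : Finset (Fin ℓ) → MvPolynomial (Fin ℓ) ℂ) Finset.univ := by
  have hQ' : Q = ∏ i, LF.lin (c i) := hQ
  clear hQ hess
  subst hQ'
  set Q := ∏ i, LF.lin (c i) with hQ
  have hne : Q ≠ 0 := LF.Q_ne c hnz hprop
  have hd : ∀ (ν : logForms ℓ Q (ℓ - p)) (μ : logForms ℓ Q p),
      ∃ x, wedgeP p (μ : Finset (Fin ℓ) → MvPolynomial (Fin ℓ) ℂ)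
          (ν : Finset (Fin ℓ) → MvPolynomial (Fin ℓ) ℂ) Finset.univ = Q * x :=
    fun ν μ => LF.pair_Q c hnz hprop p (ℓ - p) μ.1 ν.1 μ.2 ν.2
  choose F hF using hd
  let Φ : logForms ℓ Q (ℓ - p) →ₗ[MvPolynomial (Fin ℓ) ℂ]
      Module.Dual (MvPolynomial (Fin ℓ) ℂ) (logForms ℓ Q p) :=
    LinearMap.mk₂ _ F
      (fun a b m => mul_left_cancel₀ hne (by
        rw [mul_add, ← hF, ← hF, ← hF, Submodule.coe_add, LF.wedgeP_add_right]))
      (fun r a m => mul_left_cancel₀ hne (by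
        rw [smul_eq_mul, mul_left_comm, ← hF, ← hF, Submodule.coe_smul, LF.wedgeP_smul_right]))
      (fun a b m => mul_left_cancel₀ hne (by
        rw [mul_add, ← hF, ← hF, ← hF, Submodule.coe_add, LF.wedgeP_add_left]))
      (fun r a m => mul_left_cancel₀ hne (by
        rw [smul_eq_mul, mul_left_comm, ← hF, ← hF, Submodule.coe_smul, LF.wedgeP_smul_left]))
  have hΦ : ∀ ν μ, Φ ν μ = F ν μ := fun ν μ => rfl
  have hb : Function.Bijective Φ := by
    refine ⟨?_, ?_⟩
    · rw [← LinearMap.ker_eq_bot, LinearMap.ker_eq_bot']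
      intro ν h
      ext1
      refine LF.inj c hnz hprop p hp ν.1 ν.2 fun μ => ?_
      rw [hF, ← hΦ, h]; simp
    · intro φ
      obtain ⟨ν, hν, h⟩ := LF.surj c hnz hprop p hp φ
      refine ⟨⟨ν, hν⟩, ?_⟩
      ext1 μ
      apply mul_left_cancel₀ hne
      rw [hΦ, ← hF, h μ]
  refine ⟨LinearEquiv.ofBijective Φ hb, fun ν μ => ?_⟩
  rw [LinearEquiv.ofBijective_apply, hΦ, ← hF]
end

section
/- If A is an irreducible central essential arrangement, then the intersection of the closure of Σ(A) in V × C^n with the fiber over x = 0 equals {(0, λ) : Σ_{i=1}^n λ_i = 0}. -/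
/-- Irreducibility of the arrangement with forms `f_i(x) = ∑_j c i j x_j`: no direct-sum
decomposition `V = V₁ ⊕ V₂` with a nontrivial partition of the hyperplanes into forms
vanishing on one of the factors. -/
def ArrIrreducible {ℓ n : ℕ} (c : Fin n → Fin ℓ → ℂ) : Prop :=
  ¬ ∃ (U W : Submodule ℂ (Fin ℓ → ℂ)) (P : Fin n → Prop),
      IsCompl U W ∧ U ≠ ⊥ ∧ W ≠ ⊥ ∧ (∃ i, P i) ∧ (∃ i, ¬ P i) ∧
      (∀ i, P i → ∀ v ∈ W, ∑ j, c i j * v j = 0) ∧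
      (∀ i, ¬ P i → ∀ v ∈ U, ∑ j, c i j * v j = 0)


theorem arr_mvpoly_eq_zero {n : ℕ} (a : MvPolynomial (Fin n) ℂ) (y : Fin n → ℂ)
    (h : ∀ᶠ z in nhds y, MvPolynomial.eval z a = 0) : a = 0 := by
  obtain ⟨ε, hε, hb⟩ := Metric.eventually_nhds_iff_ball.1 h
  refine MvPolynomial.funext_set (fun i => Metric.ball (y i) ε) (fun i => ?_) (fun z hz => ?_)
  · exact infinite_of_mem_nhds (y i) (Metric.ball_mem_nhds _ hε)
  · rw [map_zero]
    apply hb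
    rw [ball_pi _ hε]
    exact hz

theorem arr_chevalley {σ : Type} [Fintype σ] {n : ℕ} (F : Fin n → MvPolynomial σ ℂ)
    (b : MvPolynomial σ ℂ) (hb : b ≠ 0)
    (inj : ∀ P : MvPolynomial (Fin n) ℂ, MvPolynomial.aeval F P = 0 → P = 0) :
    ∃ a : MvPolynomial (Fin n) ℂ, a ≠ 0 ∧ ∀ y, MvPolynomial.eval y a ≠ 0 →
      ∃ x, MvPolynomial.eval x b ≠ 0 ∧ ∀ i, MvPolynomial.eval x (F i) = y i := by
  let φ : MvPolynomial (Fin n) ℂ →ₐ[ℂ] MvPolynomial σ ℂ := MvPolynomial.aeval F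
  have hfp : φ.toRingHom.FinitePresentation := by
    have h1 : (φ.toRingHom).FiniteType := by
      have h2 : (φ.toRingHom.comp (algebraMap ℂ (MvPolynomial (Fin n) ℂ))).FiniteType := by
        have : φ.toRingHom.comp (algebraMap ℂ (MvPolynomial (Fin n) ℂ)) =
          algebraMap ℂ (MvPolynomial σ ℂ) := by
          ext x : 1
          simp [φ]
        rw [this, RingHom.finiteType_algebraMap]
        infer_instance
      exact RingHom.FiniteType.of_comp_finiteType h2
    exact RingHom.FinitePresentation.of_finiteType.1 h1
  have hc := PrimeSpectrum.isConstructible_comap_image hfp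
    (PrimeSpectrum.isConstructible_basicOpen (f := b))
  obtain ⟨S, hS⟩ := PrimeSpectrum.exists_constructibleSetData_iff.2 hc
  have hbot : (⊥ : PrimeSpectrum (MvPolynomial (Fin n) ℂ)) ∈ S.toSet := by
    rw [hS]
    refine ⟨⊥, ?_, ?_⟩
    · show b ∉ (⊥ : Ideal _)
      simpa using hb
    · ext P
      constructor
      · intro hP
        have : φ P = 0 := hP
        have := inj P this
        subst this
        simp
      · intro hP
        have : P = 0 := hP
        subst this
        simp
  simp only [PrimeSpectrum.ConstructibleSetData.toSet, Set.mem_iUnion] at hbot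
  obtain ⟨C, hCS, hz, hf⟩ := hbot
  have hf0 : C.f ≠ 0 := by
    intro h
    apply hf
    simp [h]
  refine ⟨C.f, hf0, fun y hy => ?_⟩
  let m : PrimeSpectrum (MvPolynomial (Fin n) ℂ) :=
    ⟨RingHom.ker (MvPolynomial.eval y), RingHom.ker_isPrime _⟩
  have hm : m ∈ S.toSet := by
    simp only [PrimeSpectrum.ConstructibleSetData.toSet, Set.mem_iUnion]
    refine ⟨C, hCS, ?_, ?_⟩
    · rw [PrimeSpectrum.mem_zeroLocus] at hz ⊢
      intro g hg
      have : g = 0 := hz hg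
      subst this
      simp
    · rw [PrimeSpectrum.mem_zeroLocus]
      intro h
      have : C.f ∈ RingHom.ker (MvPolynomial.eval y) := h rfl
      exact hy this
  rw [hS] at hm
  obtain ⟨q, hq, hqm⟩ := hm
  have hbq : b ∉ q.asIdeal := hq
  have hqp := q.2
  rw [← MvPolynomial.IsPrime.vanishingIdeal_zeroLocus (K := ℂ) q.asIdeal,
    MvPolynomial.mem_vanishingIdeal_iff] at hbq
  push Not at hbq
  obtain ⟨x, hx, hbx⟩ := hbq
  refine ⟨x, by simpa only [MvPolynomial.aeval_eq_eval] using hbx, fun i => ?_⟩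
  have h1 : (MvPolynomial.X i - MvPolynomial.C (y i) : MvPolynomial (Fin n) ℂ) ∈ m.asIdeal := by
    show _ ∈ RingHom.ker _
    simp [RingHom.mem_ker]
  rw [← hqm] at h1
  have h2 : φ (MvPolynomial.X i - MvPolynomial.C (y i)) ∈ q.asIdeal := h1
  have h3 := MvPolynomial.mem_zeroLocus_iff.1 hx _ h2
  simp only [φ, map_sub, MvPolynomial.aeval_X, MvPolynomial.aeval_C, MvPolynomial.algebraMap_eq] at h3
  simp only [MvPolynomial.aeval_eq_eval] at h3
  simpa [sub_eq_zero] using h3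

theorem arr_dense {σ : Type} [Fintype σ] [DecidableEq σ] {n : ℕ}
    (A B : (σ → ℂ) →ₗ[ℂ] (Fin n → ℂ)) (D : (σ → ℂ) →ₗ[ℂ] ℂ) (x0 : σ → ℂ)
    (hA : ∀ i, ∃ x, A x i ≠ 0)
    (hs : ∀ μ : Fin n → ℂ, (∀ v, ∑ i, μ i * (A v i * B x0 i + A x0 i * B v i + D v) = 0) → μ = 0) :
    Dense {y : Fin n → ℂ | ∃ x, (∀ i, A x i ≠ 0) ∧ ∀ i, A x i * B x i + D x = y i} := by
  let lin : ((σ → ℂ) →ₗ[ℂ] ℂ) → MvPolynomial σ ℂ := fun g =>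
    ∑ s, MvPolynomial.C (g (Pi.single s 1)) * MvPolynomial.X s
  have hlin : ∀ g x, MvPolynomial.eval x (lin g) = g x := by
    intro g x
    simp only [lin, map_sum, map_mul, MvPolynomial.eval_C, MvPolynomial.eval_X]
    conv_rhs => rw [LinearMap.pi_apply_eq_sum_univ g x]
    refine Finset.sum_congr rfl fun s _ => ?_
    rw [smul_eq_mul, mul_comm]
    congr 2
    ext j
    simp [Pi.single_apply, eq_comm]
  let F : Fin n → MvPolynomial σ ℂ := fun i =>
    lin (LinearMap.proj i ∘ₗ A) * lin (LinearMap.proj i ∘ₗ B) + lin D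
  let b : MvPolynomial σ ℂ := ∏ i, lin (LinearMap.proj i ∘ₗ A)
  have hF : ∀ i x, MvPolynomial.eval x (F i) = A x i * B x i + D x := by
    intro i x
    simp [F, hlin]
  have hb : b ≠ 0 := by
    rw [Finset.prod_ne_zero_iff]
    intro i _ h
    obtain ⟨x, hx⟩ := hA i
    apply hx
    have := hlin (LinearMap.proj i ∘ₗ A) x
    rw [h] at this
    simpa using this.symm
  let G : (σ → ℂ) → (Fin n → ℂ) := fun x i => A x i * B x i + D x
  let A' := LinearMap.toContinuousLinearMap A
  let B' := LinearMap.toContinuousLinearMap B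
  let D' := LinearMap.toContinuousLinearMap D
  let pr : Fin n → ((Fin n → ℂ) →L[ℂ] ℂ) := fun i => ContinuousLinearMap.proj i
  let G' : (σ → ℂ) →L[ℂ] (Fin n → ℂ) := ContinuousLinearMap.pi fun i =>
    ((pr i ∘L A') x0 • (pr i ∘L B') + (pr i ∘L B') x0 • (pr i ∘L A')) + D'
  have hG : HasStrictFDerivAt G G' x0 := by
    rw [hasStrictFDerivAt_pi']
    intro i
    have h1 : HasStrictFDerivAt (fun x => A x i) (pr i ∘L A') x0 :=
      (pr i ∘L A').hasStrictFDerivAt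
    have h2 : HasStrictFDerivAt (fun x => B x i) (pr i ∘L B') x0 :=
      (pr i ∘L B').hasStrictFDerivAt
    have h3 : HasStrictFDerivAt (fun x => D x) D' x0 := D'.hasStrictFDerivAt
    exact (h1.mul h2).add h3
  have hG'v : ∀ v i, G' v i = A v i * B x0 i + A x0 i * B v i + D v := by
    intro v i
    simp [G', pr, A', B', D']
    ring
  have hsurj : G'.range = ⊤ := by
    by_contra hne
    obtain ⟨f, hf0, hf⟩ := Submodule.exists_le_ker_of_lt_top _ (lt_top_iff_ne_top.2 hne)
    apply hf0
    have hfs : ∀ z, f z = ∑ i, f (Pi.single i 1) * z i := by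
      intro z
      conv_lhs => rw [LinearMap.pi_apply_eq_sum_univ f z]
      refine Finset.sum_congr rfl fun s _ => ?_
      rw [smul_eq_mul, mul_comm]
      congr 2
      ext j
      simp [Pi.single_apply, eq_comm]
    have := hs (fun i => f (Pi.single i 1)) (fun v => by
      have h1 : f (G' v) = 0 := hf ⟨v, rfl⟩
      rw [hfs] at h1
      simpa only [hG'v] using h1)
    ext i
    simpa using congrFun this i
  have hmap := hG.map_nhds_eq_of_surj hsurj
  have inj : ∀ P : MvPolynomial (Fin n) ℂ, MvPolynomial.aeval F P = 0 → P = 0 := by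
    intro P hP
    apply arr_mvpoly_eq_zero P (G x0)
    rw [← hmap, Filter.eventually_map]
    refine Filter.Eventually.of_forall fun x => ?_
    have : MvPolynomial.eval x (MvPolynomial.aeval F P) = 0 := by rw [hP, map_zero]
    rw [← this, MvPolynomial.aeval_def, MvPolynomial.algebraMap_eq, ← MvPolynomial.coe_eval₂Hom]
    have hh : (MvPolynomial.eval x).comp (MvPolynomial.eval₂Hom MvPolynomial.C F)
        = MvPolynomial.eval (G x) := by
      ext i
      · simp
      · simp [G, hF]
    rw [← hh]; rfl
  obtain ⟨a, ha0, ha⟩ := arr_chevalley F b hb inj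
  intro y
  rw [mem_closure_iff_nhds]
  intro t ht
  by_contra hcon
  apply ha0
  apply arr_mvpoly_eq_zero a y
  filter_upwards [ht] with z hz
  by_contra hza
  apply hcon
  obtain ⟨x, hx, hxy⟩ := ha z hza
  refine ⟨z, hz, x, fun i hi => hx ?_, fun i => ?_⟩
  · simp only [b, map_prod]
    apply Finset.prod_eq_zero (Finset.mem_univ i)
    rw [hlin]; exact hi
  · rw [← hF]; exact hxy i

open Matrix in
/-- mutual orthogonality -/
def ArrMP {n : ℕ} (L N : Submodule ℂ (Fin n → ℂ)) : Prop :=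
  (∀ w, w ∈ N ↔ ∀ f ∈ L, f ⬝ᵥ w = 0) ∧ (∀ f, f ∈ L ↔ ∀ w ∈ N, f ⬝ᵥ w = 0)

open Matrix in
theorem ArrMP.of_left {n : ℕ} {L N : Submodule ℂ (Fin n → ℂ)}
    (h : ∀ w, w ∈ N ↔ ∀ f ∈ L, f ⬝ᵥ w = 0) : ArrMP L N := by
  refine ⟨h, fun f => ⟨fun hf w hw => (h w).1 hw f hf, fun hf => ?_⟩⟩
  by_contra hfL
  obtain ⟨φ, hφ, hle⟩ := Submodule.exists_le_ker_of_notMem hfL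
  have hfs : ∀ z, φ z = z ⬝ᵥ (fun i => φ (Pi.single i 1)) := by
    intro z
    conv_lhs => rw [LinearMap.pi_apply_eq_sum_univ φ z]
    refine Finset.sum_congr rfl fun s _ => ?_
    rw [smul_eq_mul]
    congr 2
    ext j
    simp [Pi.single_apply, eq_comm]
  apply hφ
  rw [hfs]
  apply hf
  rw [h]
  intro g hg
  rw [← hfs]
  exact hle hg

theorem ArrMP.symm {n : ℕ} {L N : Submodule ℂ (Fin n → ℂ)} (h : ArrMP L N) : ArrMP N L :=
  ⟨fun w => by rw [h.2]; simp only [dotProduct_comm], fun w => by rw [h.1]; simp only [dotProduct_comm]⟩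

def ArrIrr {n : ℕ} (L : Submodule ℂ (Fin n → ℂ)) : Prop :=
  ∀ S : Set (Fin n), (∀ f ∈ L, S.indicator f ∈ L) → S = ∅ ∨ S = Set.univ

theorem arr_indicator_dot {n : ℕ} (S : Set (Fin n)) (f w : Fin n → ℂ) :
    f ⬝ᵥ S.indicator w = S.indicator f ⬝ᵥ w := by
  classical
  refine Finset.sum_congr rfl fun i _ => ?_
  by_cases h : i ∈ S <;> simp [h]

theorem ArrIrr.dual {n : ℕ} {L N : Submodule ℂ (Fin n → ℂ)} (h : ArrMP L N) (hL : ArrIrr L) :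
    ArrIrr N := by
  intro S hS
  apply hL S
  intro f hf
  rw [h.2]
  intro w hw
  rw [← arr_indicator_dot]
  exact (h.2 f).1 hf _ (hS w hw)

def ArrGood {n : ℕ} (L N : Submodule ℂ (Fin n → ℂ)) (f w : Fin n → ℂ) : Prop :=
  ∀ μ : Fin n → ℂ, μ * f ∈ L → μ * w ∈ N → ∃ c, ∀ i, μ i = c

theorem ArrGood.perturb {n : ℕ} {L N : Submodule ℂ (Fin (n + 1) → ℂ)} {f w g : Fin (n + 1) → ℂ}
    (hf : f ∈ L) (hw : w ∈ N) (hg : g ∈ L) (h : ArrGood L N f w) :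
    ∃ t : ℂ, t ≠ 0 ∧ ArrGood L N (f + t • g) w := by
  let K : Set (Fin (n + 1) → ℂ) := Metric.sphere 0 1
  have : CompactSpace K := isCompact_iff_compactSpace.1 (isCompact_sphere _ _)
  let Z : Set (K × ℂ) := {p | p.1.1 0 = 0 ∧ p.1.1 * (f + p.2 • g) ∈ L ∧ p.1.1 * w ∈ N}
  have hZ : IsClosed Z := by
    refine IsClosed.inter ?_ (IsClosed.inter ?_ ?_)
    · exact isClosed_eq ((continuous_apply 0).comp (continuous_subtype_val.comp continuous_fst)) continuous_const
    · exact (Submodule.closed_of_finiteDimensional L).preimage (by fun_prop)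
    · exact (Submodule.closed_of_finiteDimensional N).preimage (by fun_prop)
  have hpr : IsClosed (Prod.snd '' Z) := isClosedMap_snd_of_compactSpace _ hZ
  have h0 : (0 : ℂ) ∈ (Prod.snd '' Z)ᶜ := by
    rintro ⟨⟨⟨μ, hμ⟩, t⟩, ⟨h1, h2, h3⟩, rfl⟩
    simp only [zero_smul, add_zero] at h2
    obtain ⟨c, hc⟩ := h μ h2 h3
    have : μ = 0 := by
      ext i
      rw [hc i, ← hc 0]; exact h1
    simp [K, this] at hμ
  have hn := hpr.isOpen_compl.mem_nhds h0
  have hex : ∃ t ∈ (Prod.snd '' Z)ᶜ, t ≠ 0 := by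
    have h1 : ∀ᶠ t in nhdsWithin (0 : ℂ) {0}ᶜ, t ∈ (Prod.snd '' Z)ᶜ := nhdsWithin_le_nhds hn
    obtain ⟨t, ht, ht'⟩ := (h1.and self_mem_nhdsWithin).exists
    exact ⟨t, ht, ht'⟩
  obtain ⟨t, ht, ht0⟩ := hex
  refine ⟨t, ht0, fun μ h1 h2 => ⟨μ 0, ?_⟩⟩
  by_contra hcon
  let ν : Fin (n + 1) → ℂ := μ - fun _ => μ 0
  have hν : ν ≠ 0 := by
    intro h
    apply hcon
    intro i
    have := congrFun h i
    simpa [ν, sub_eq_zero] using this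
  have e1 : ν * (f + t • g) = μ * (f + t • g) - μ 0 • (f + t • g) := by
    ext i; simp [ν]; ring
  have e2 : ν * w = μ * w - μ 0 • w := by
    ext i; simp [ν]; ring
  apply ht
  refine ⟨⟨⟨((‖ν‖⁻¹ : ℝ) : ℂ) • ν, ?_⟩, t⟩, ⟨?_, ?_, ?_⟩, rfl⟩
  · simp [K, norm_smul, hν]
  · simp [ν]
  · show (((‖ν‖⁻¹ : ℝ) : ℂ) • ν) * (f + t • g) ∈ L
    rw [smul_mul_assoc, e1]
    exact L.smul_mem _ (L.sub_mem h1 (L.smul_mem _ (L.add_mem hf (L.smul_mem _ hg))))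
  · show (((‖ν‖⁻¹ : ℝ) : ℂ) • ν) * w ∈ N
    rw [smul_mul_assoc, e2]
    exact N.smul_mem _ (N.sub_mem h2 (N.smul_mem _ hw))

def arrTail (n : ℕ) : (Fin (n + 1) → ℂ) →ₗ[ℂ] (Fin n → ℂ) where
  toFun f := Fin.tail f
  map_add' _ _ := rfl
  map_smul' _ _ := rfl

theorem arrTail_apply (n : ℕ) (f : Fin (n + 1) → ℂ) (i : Fin n) : arrTail n f i = f i.succ := rfl

def arrCons (n : ℕ) : (Fin n → ℂ) →ₗ[ℂ] (Fin (n + 1) → ℂ) where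
  toFun f := Fin.cons 0 f
  map_add' f g := by ext i; refine Fin.cases ?_ (fun i => ?_) i <;> simp
  map_smul' c g := by ext i; refine Fin.cases ?_ (fun i => ?_) i <;> simp

theorem ArrMP.minor {n : ℕ} {L N : Submodule ℂ (Fin (n + 1) → ℂ)} (h : ArrMP L N) :
    ArrMP (L.map (arrTail n)) (N.comap (arrCons n)) := by
  apply ArrMP.of_left
  intro w
  rw [Submodule.mem_comap, h.1]
  have key : ∀ f : Fin (n + 1) → ℂ, f ⬝ᵥ arrCons n w = arrTail n f ⬝ᵥ w := by
    intro f
    simp [dotProduct, Fin.sum_univ_succ, arrCons, arrTail_apply]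
  constructor
  · rintro hw _ ⟨f, hf, rfl⟩
    rw [← key]; exact hw f hf
  · intro hw f hf
    rw [key]; exact hw _ ⟨f, hf, rfl⟩

theorem arr_step {n : ℕ} {L N : Submodule ℂ (Fin (n + 2) → ℂ)}
    (hδ : Pi.single 0 1 ∉ L) (hg : ∃ g ∈ L, g 0 ≠ 0)
    (hex : ∃ f ∈ L.map (arrTail (n + 1)), ∃ w ∈ N.comap (arrCons (n + 1)),
      ArrGood (L.map (arrTail (n + 1))) (N.comap (arrCons (n + 1))) f w) :
    ∃ f ∈ L, ∃ w ∈ N, ArrGood L N f w := by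
  obtain ⟨_, ⟨f, hf, rfl⟩, w, hw, hgood⟩ := hex
  obtain ⟨g, hgL, hg0⟩ := hg
  have main : ∀ f ∈ L, f 0 ≠ 0 →
      ArrGood (L.map (arrTail (n + 1))) (N.comap (arrCons (n + 1))) (arrTail (n + 1) f) w →
      ∃ f ∈ L, ∃ w ∈ N, ArrGood L N f w := by
    intro f hf hf0 hgood
    refine ⟨f, hf, arrCons (n + 1) w, hw, fun μ h1 h2 => ?_⟩
    obtain ⟨c, hc⟩ := hgood (arrTail (n + 1) μ) ⟨_, h1, rfl⟩ (by
      rw [Submodule.mem_comap]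
      convert h2 using 1
      ext i; refine Fin.cases ?_ (fun i => ?_) i <;> simp [arrCons, arrTail_apply])
    have hc' : ∀ i : Fin (n + 1), μ i.succ = c := hc
    refine ⟨c, fun i => ?_⟩
    refine Fin.cases ?_ hc' i
    by_contra hne
    apply hδ
    have h3 : μ * f - c • f ∈ L := L.sub_mem h1 (L.smul_mem _ hf)
    have h4 : μ * f - c • f = ((μ 0 - c) * f 0) • Pi.single 0 1 := by
      ext i; refine Fin.cases ?_ (fun i => ?_) i
      · simp; ring
      · simp [hc']
    rw [h4] at h3
    exact (L.smul_mem_iff (mul_ne_zero (sub_ne_zero.2 hne) hf0)).1 h3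
  by_cases hf0 : f 0 = 0
  · obtain ⟨t, ht, hgood'⟩ := ArrGood.perturb (g := arrTail (n + 1) g)
      (Submodule.mem_map_of_mem hf) hw (Submodule.mem_map_of_mem hgL) hgood
    refine main (f + t • g) (L.add_mem hf (L.smul_mem _ hgL)) (by simp [hf0, ht, hg0]) ?_
    rwa [map_add, map_smul]
  · exact main f hf hf0 hgood

/-- Linear form of Tutte's theorem. -/
theorem arr_tutte {n : ℕ} {L : Submodule ℂ (Fin (n + 1) → ℂ)} (hL : ArrIrr L)
    (hδ : Pi.single 0 1 ∉ L) : ArrIrr (L.map (arrTail n)) ∨ ArrIrr (L.comap (arrCons n)) := by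
  by_contra hcon
  rw [not_or] at hcon
  obtain ⟨h1, h2⟩ := hcon
  unfold ArrIrr at h1 h2
  push Not at h1 h2
  obtain ⟨S, hS, hS0, hS1⟩ := h1
  obtain ⟨Q, hQ, hQ0, hQ1⟩ := h2
  -- p f = element of L with tail the indicator
  have ext0 : ∀ f g, f ∈ L → g ∈ L → (∀ i : Fin n, f i.succ = g i.succ) → f = g := by
    intro f g hf hg h
    by_contra hne
    apply hδ
    have h3 : f - g ∈ L := L.sub_mem hf hg
    have h4 : f - g = (f 0 - g 0) • Pi.single 0 1 := by
      ext i; refine Fin.cases ?_ (fun i => ?_) i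
      · simp
      · simp [h]
    rw [h4] at h3
    refine (L.smul_mem_iff (sub_ne_zero.2 fun h0 => hne ?_)).1 h3
    ext i; exact Fin.cases h0 h i
  have hind : ∀ (T : Set (Fin n)) (f : Fin (n + 1) → ℂ),
      (Fin.succ '' T).indicator f = arrCons n (T.indicator (arrTail n f)) := by
    intro T f
    classical
    ext i; refine Fin.cases ?_ (fun i => ?_) i
    · simp [arrCons, Set.indicator]
    · by_cases h : i ∈ T <;> simp [arrCons, arrTail_apply, Set.indicator, h]
  -- if T nonempty, then L is not stable under T with 0
  have nost : ∀ T : Set (Fin n), T.Nonempty →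
      (∀ f ∈ L, ∃ g ∈ L, g 0 = 0 ∧ ∀ i : Fin n, g i.succ = T.indicator (arrTail n f) i) → False := by
    intro T hT h
    have hst : ∀ f ∈ L, (Fin.succ '' T).indicator f ∈ L := by
      intro f hf
      obtain ⟨g, hg, hg0, hgi⟩ := h f hf
      rw [hind]
      convert hg using 1
      ext i; refine Fin.cases ?_ (fun i => ?_) i
      · simp [arrCons, hg0]
      · simp [arrCons, hgi]
    rcases hL (Fin.succ '' T) hst with h' | h'
    · rw [Set.image_eq_empty] at h'; exact hT.ne_empty h'
    · have : (0 : Fin (n + 1)) ∈ Fin.succ '' T := by rw [h']; trivial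
      obtain ⟨i, -, hi⟩ := this
      exact Fin.succ_ne_zero i hi
  have cpl : ∀ (T : Set (Fin n)) (f : Fin n → ℂ) i, Tᶜ.indicator f i = f i - T.indicator f i := by
    intro T f i
    classical
    by_cases h : i ∈ T <;> simp [h]
  have hSc0 : Sᶜ.Nonempty := by rwa [Set.nonempty_compl]
  have hQc0 : Qᶜ.Nonempty := by rwa [Set.nonempty_compl]
  -- stable operations
  have opS : ∀ f ∈ L, ∃ g ∈ L, ∀ i : Fin n, g i.succ = S.indicator (arrTail n f) i := by
    intro f hf
    obtain ⟨g, hg, hgi⟩ := hS _ ⟨f, hf, rfl⟩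
    exact ⟨g, hg, fun i => congrFun hgi i⟩
  have opSc : ∀ f ∈ L, ∃ g ∈ L, ∀ i : Fin n, g i.succ = Sᶜ.indicator (arrTail n f) i := by
    intro f hf
    obtain ⟨g, hg, hgi⟩ := opS f hf
    refine ⟨f - g, L.sub_mem hf hg, fun i => ?_⟩
    rw [cpl, ← hgi]; rfl
  have opQ : ∀ f ∈ L, f 0 = 0 → ∃ g ∈ L, g 0 = 0 ∧ ∀ i : Fin n, g i.succ = Q.indicator (arrTail n f) i := by
    intro f hf hf0
    have := hQ (arrTail n f) (by
      rw [Submodule.mem_comap]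
      convert hf using 1
      ext i; refine Fin.cases ?_ (fun i => ?_) i <;> simp [arrCons, arrTail_apply, hf0])
    exact ⟨_, this, by simp [arrCons], fun i => by simp [arrCons]⟩
  -- for T = S or Sᶜ: Q∩T stable
  have part : ∀ T : Set (Fin n), Tᶜ.Nonempty →
      (∀ f ∈ L, ∃ g ∈ L, ∀ i : Fin n, g i.succ = T.indicator (arrTail n f) i) →
      (∀ f ∈ L, ∃ g ∈ L, ∀ i : Fin n, g i.succ = Tᶜ.indicator (arrTail n f) i) →
      ∀ f ∈ L, ∃ g ∈ L, ∀ i : Fin n, g i.succ = (T ∩ Q).indicator (arrTail n f) i := by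
    intro T hT opT opTc f hf
    -- exists t ∈ L supported (off 0) on Tᶜ with t 0 ≠ 0
    have : ∃ t ∈ L, t 0 ≠ 0 ∧ ∀ i ∈ T, t (Fin.succ i) = 0 := by
      by_contra hno
      push Not at hno
      refine nost Tᶜ hT fun f hf => ?_
      obtain ⟨g, hg, hgi⟩ := opTc f hf
      refine ⟨g, hg, ?_, hgi⟩
      by_contra hg0
      obtain ⟨i, hi, hi'⟩ := hno g hg hg0
      apply hi'
      rw [hgi]; simp [hi]
    obtain ⟨t, ht, ht0, hti⟩ := this
    obtain ⟨g, hg, -, hgi⟩ := opQ (f - (f 0 / t 0) • t) (L.sub_mem hf (L.smul_mem _ ht))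
      (by simp [ht0])
    obtain ⟨k, hk, hki⟩ := opT g hg
    refine ⟨k, hk, fun i => ?_⟩
    rw [hki]
    classical
    by_cases h : i ∈ T
    · have := hgi i
      by_cases h' : i ∈ Q <;> simp [h, h', arrTail_apply, this, hti i h]
    · simp [h]
  have opQ' : ∀ f ∈ L, ∃ g ∈ L, ∀ i : Fin n, g i.succ = Q.indicator (arrTail n f) i := by
    intro f hf
    obtain ⟨g, hg, hgi⟩ := part S hSc0 opS opSc f hf
    obtain ⟨k, hk, hki⟩ := part Sᶜ (by rwa [compl_compl]) opSc
      (by rwa [compl_compl]) f hf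
    refine ⟨g + k, L.add_mem hg hk, fun i => ?_⟩
    rw [Pi.add_apply, hgi, hki]
    classical
    by_cases h : i ∈ S <;> by_cases h' : i ∈ Q <;> simp [h, h']
  have opQc' : ∀ f ∈ L, ∃ g ∈ L, ∀ i : Fin n, g i.succ = Qᶜ.indicator (arrTail n f) i := by
    intro f hf
    obtain ⟨g, hg, hgi⟩ := opQ' f hf
    refine ⟨f - g, L.sub_mem hf hg, fun i => ?_⟩
    rw [cpl, ← hgi]; rfl
  have ex : ∀ T : Set (Fin n), T.Nonempty →
      (∀ f ∈ L, ∃ g ∈ L, ∀ i : Fin n, g i.succ = T.indicator (arrTail n f) i) →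
      ∃ x ∈ L, x 0 ≠ 0 ∧ ∀ i ∉ T, x (Fin.succ i) = 0 := by
    intro T hT opT
    by_contra hno
    push Not at hno
    refine nost T hT fun f hf => ?_
    obtain ⟨g, hg, hgi⟩ := opT f hf
    refine ⟨g, hg, ?_, hgi⟩
    by_contra hg0
    obtain ⟨i, hi, hi'⟩ := hno g hg hg0
    apply hi'
    rw [hgi]; simp [hi]
  obtain ⟨x, hx, hx0, hxi⟩ := ex Q hQ0 opQ'
  obtain ⟨y, hy, hy0, hyi⟩ := ex Qᶜ hQc0 opQc'
  obtain ⟨g, hg, hg0, hgi⟩ := opQ (x - (x 0 / y 0) • y) (L.sub_mem hx (L.smul_mem _ hy)) (by simp [hy0])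
  have : g = x := by
    refine ext0 g x hg hx fun i => ?_
    rw [hgi]
    by_cases h : i ∈ Q
    · simp [h, arrTail_apply, hyi i (by simpa using h)]
    · simp [h, hxi i h]
  rw [this] at hg0
  exact hx0 hg0

theorem arr_noloop {n : ℕ} {L : Submodule ℂ (Fin (n + 2) → ℂ)} (hL : ArrIrr L) :
    Pi.single 0 1 ∉ L ∧ ∃ g ∈ L, g 0 ≠ 0 := by
  have hS : ¬ (({0} : Set (Fin (n + 2))) = ∅ ∨ ({0} : Set (Fin (n + 2))) = Set.univ) := by
    rintro (h | h)
    · simp at h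
    · have : (1 : Fin (n + 2)) ∈ ({0} : Set (Fin (n + 2))) := by rw [h]; trivial
      simp at this
  have key : ∀ f : Fin (n + 2) → ℂ, ({0} : Set (Fin (n + 2))).indicator f = f 0 • Pi.single 0 1 := by
    intro f
    classical
    ext i; refine Fin.cases ?_ (fun i => ?_) i <;> simp [Set.indicator]
  constructor
  · intro h
    refine hS (hL {0} fun f hf => ?_)
    rw [key]; exact L.smul_mem _ h
  · by_contra hno
    push Not at hno
    refine hS (hL {0} fun f hf => ?_)
    rw [key, hno f hf, zero_smul]; exact L.zero_mem

theorem arr_good : ∀ (n : ℕ) (L N : Submodule ℂ (Fin n → ℂ)), ArrMP L N → ArrIrr L →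
    ∃ f ∈ L, ∃ w ∈ N, ArrGood L N f w
  | 0, L, N, _, _ => ⟨0, L.zero_mem, 0, N.zero_mem, fun _ _ _ => ⟨0, fun i => i.elim0⟩⟩
  | 1, L, N, _, _ => ⟨0, L.zero_mem, 0, N.zero_mem, fun μ _ _ => ⟨μ 0, fun i => by
      rw [Subsingleton.elim i 0]⟩⟩
  | n + 2, L, N, hMP, hL => by
    have hN := hL.dual hMP
    obtain ⟨h1, h2⟩ := arr_noloop hL
    obtain ⟨h3, h4⟩ := arr_noloop hN
    rcases arr_tutte hL h1 with h | h
    · exact arr_step h1 h2 (arr_good (n + 1) _ _ hMP.minor h)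
    · have h5 := hMP.symm.minor
      obtain ⟨w, hw, f, hf, hg⟩ := arr_step h3 h4 (arr_good (n + 1) _ _ h5 (h.dual h5.symm))
      exact ⟨f, hf, w, hw, fun μ a b => hg μ b a⟩

theorem arr_irr_range {ℓ n : ℕ} (c : Fin n → Fin ℓ → ℂ) (hnz : ∀ i, c i ≠ 0)
    (hess : Submodule.span ℂ (Set.range c) = ⊤) (hirr : ArrIrreducible c)
    (cm : (Fin ℓ → ℂ) →ₗ[ℂ] (Fin n → ℂ)) (hcm : ∀ x i, cm x i = ∑ j, c i j * x j) :
    ArrIrr (LinearMap.range cm) := by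
  have hinj : ∀ x, (∀ i, cm x i = 0) → x = 0 := by
    intro x hx
    let φ : (Fin ℓ → ℂ) →ₗ[ℂ] ℂ :=
      { toFun := fun v => ∑ j, v j * x j
        map_add' := fun u v => by simp [add_mul, Finset.sum_add_distrib]
        map_smul' := fun a v => by simp [Finset.mul_sum, mul_assoc] }
    have hle : Submodule.span ℂ (Set.range c) ≤ LinearMap.ker φ := by
      rw [Submodule.span_le]
      rintro _ ⟨i, rfl⟩
      exact (hcm x i).symm.trans (hx i)
    rw [hess] at hle
    ext j
    have h1 : φ (Pi.single j 1) = 0 := hle trivial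
    simpa [φ, Pi.single_apply] using h1
  intro S hS
  by_contra hcon
  rw [not_or] at hcon
  obtain ⟨hS0, hS1⟩ := hcon
  apply hirr
  let U : Submodule ℂ (Fin ℓ → ℂ) :=
    { carrier := {x | ∀ i, i ∉ S → cm x i = 0}
      add_mem' := fun {a b} ha hb i hi => by simp [ha i hi, hb i hi]
      zero_mem' := fun i _ => by simp
      smul_mem' := fun t a ha i hi => by simp [ha i hi] }
  let W : Submodule ℂ (Fin ℓ → ℂ) :=
    { carrier := {x | ∀ i, i ∈ S → cm x i = 0}
      add_mem' := fun {a b} ha hb i hi => by simp [ha i hi, hb i hi]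
      zero_mem' := fun i _ => by simp
      smul_mem' := fun t a ha i hi => by simp [ha i hi] }
  have hdec : ∀ x, ∃ u ∈ U, ∃ w ∈ W, u + w = x := by
    intro x
    obtain ⟨u, hu⟩ := hS (cm x) ⟨x, rfl⟩
    refine ⟨u, fun i hi => ?_, x - u, fun i hi => ?_, by abel⟩
    · rw [hu]; simp [hi]
    · rw [map_sub, hu]; simp [hi]
  have hnz' : ∀ i, ∃ x, cm x i ≠ 0 := by
    intro i
    obtain ⟨j, hj⟩ := Function.ne_iff.1 (hnz i)
    refine ⟨Pi.single j 1, ?_⟩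
    rw [hcm]
    simpa [Pi.single_apply] using hj
  have hSne : S.Nonempty := Set.nonempty_iff_ne_empty.2 hS0
  have hScne : ∃ i, i ∉ S := by
    by_contra h
    push Not at h
    exact hS1 (Set.eq_univ_of_forall h)
  refine ⟨U, W, fun i => i ∈ S, ⟨?_, ?_⟩, ?_, ?_, hSne, hScne, ?_, ?_⟩
  · rw [Submodule.disjoint_def]
    intro x hxU hxW
    apply hinj
    intro i
    by_cases hi : i ∈ S
    · exact hxW i hi
    · exact hxU i hi
  · rw [codisjoint_iff, eq_top_iff]
    intro x _
    exact Submodule.mem_sup.2 (hdec x)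
  · intro hU
    obtain ⟨i, hi⟩ := hSne
    obtain ⟨x, hx⟩ := hnz' i
    obtain ⟨u, hu, w, hw, rfl⟩ := hdec x
    rw [hU, Submodule.mem_bot] at hu
    apply hx
    rw [hu, zero_add]
    exact hw i hi
  · intro hW
    obtain ⟨i, hi⟩ := hScne
    obtain ⟨x, hx⟩ := hnz' i
    obtain ⟨u, hu, w, hw, rfl⟩ := hdec x
    rw [hW, Submodule.mem_bot] at hw
    apply hx
    rw [hw, add_zero]
    exact hu i hi
  · intro i hi v hv
    rw [← hcm]; exact hv i hi
  · intro i hi v hv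
    rw [← hcm]; exact hv i hi

theorem arr_closure_proj {ℓ n : ℕ} (c : Fin n → Fin ℓ → ℂ) (hnz : ∀ i, c i ≠ 0)
    (hess : Submodule.span ℂ (Set.range c) = ⊤) (hirr : ArrIrreducible c)
    (l : Fin n → ℂ) (hl : ∑ i, l i = 0) :
    l ∈ closure {m : Fin n → ℂ | ∃ x : Fin ℓ → ℂ, (∀ i, (∑ j, c i j * x j) ≠ 0) ∧
      ∀ j, (∑ i, m i * c i j / (∑ j', c i j' * x j')) = 0} := by
  let cm : (Fin ℓ → ℂ) →ₗ[ℂ] (Fin n → ℂ) := Matrix.mulVecLin (Matrix.of c)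
  have hcm : ∀ x i, cm x i = ∑ j, c i j * x j := by
    intro x i
    simp [cm, Matrix.mulVec, dotProduct]
  let N : Submodule ℂ (Fin n → ℂ) :=
    { carrier := {w | ∀ j, ∑ i, w i * c i j = 0}
      add_mem' := fun {a b} ha hb j => by simp [add_mul, Finset.sum_add_distrib, ha j, hb j]
      zero_mem' := fun j => by simp
      smul_mem' := fun t a ha j => by simp [mul_assoc, ← Finset.mul_sum, ha j] }
  have hMP : ArrMP (LinearMap.range cm) N := by
    apply ArrMP.of_left
    intro w
    have key : ∀ x, cm x ⬝ᵥ w = ∑ j, x j * ∑ i, w i * c i j := by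
      intro x
      simp only [dotProduct, hcm, Finset.sum_mul, Finset.mul_sum]
      rw [Finset.sum_comm]
      refine Finset.sum_congr rfl fun j _ => Finset.sum_congr rfl fun i _ => by ring
    constructor
    · rintro hw _ ⟨x, rfl⟩
      rw [key]
      exact Finset.sum_eq_zero fun j _ => by rw [hw j, mul_zero]
    · intro h j
      have := h _ ⟨Pi.single j 1, rfl⟩
      rw [key] at this
      simpa [Pi.single_apply] using this
  obtain ⟨_, ⟨x0, rfl⟩, w0, hw0, hgood⟩ :=
    arr_good n _ N hMP (arr_irr_range c hnz hess hirr cm hcm)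
  obtain ⟨p, hp⟩ := LinearMap.exists_leftInverse_of_injective N.subtype N.ker_subtype
  have hp' : ∀ w (hw : w ∈ N), p w = ⟨w, hw⟩ := fun w hw => LinearMap.congr_fun hp ⟨w, hw⟩
  let A : (Fin ℓ ⊕ Fin n ⊕ Unit → ℂ) →ₗ[ℂ] (Fin n → ℂ) := cm ∘ₗ LinearMap.funLeft ℂ ℂ Sum.inl
  let B : (Fin ℓ ⊕ Fin n ⊕ Unit → ℂ) →ₗ[ℂ] (Fin n → ℂ) :=
    (N.subtype ∘ₗ p) ∘ₗ LinearMap.funLeft ℂ ℂ (fun i => Sum.inr (Sum.inl i))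
  let D : (Fin ℓ ⊕ Fin n ⊕ Unit → ℂ) →ₗ[ℂ] ℂ := LinearMap.proj (Sum.inr (Sum.inr ()))
  let mk : (Fin ℓ → ℂ) → (Fin n → ℂ) → ℂ → (Fin ℓ ⊕ Fin n ⊕ Unit → ℂ) :=
    fun x w d => Sum.elim x (Sum.elim w (fun _ => d))
  have hA : ∀ x w d, A (mk x w d) = cm x := fun x w d => rfl
  have hB : ∀ x w d, w ∈ N → B (mk x w d) = w := by
    intro x w d hw
    show ((p w : N) : Fin n → ℂ) = w
    rw [hp' w hw]
  have hD : ∀ x w d, D (mk x w d) = d := fun x w d => rfl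
  have hBN : ∀ v, B v ∈ N := fun v => (p _).2
  have hdense := arr_dense A B D (mk x0 w0 0) (fun i => by
      obtain ⟨j, hj⟩ := Function.ne_iff.1 (hnz i)
      refine ⟨mk (Pi.single j 1) 0 0, ?_⟩
      rw [hA, hcm]
      simpa [Pi.single_apply] using hj) (fun μ hμ => by
      have h1 : μ * w0 ∈ N := by
        rw [hMP.1]
        rintro _ ⟨x, rfl⟩
        have := hμ (mk x 0 0)
        rw [hA, hB _ _ _ hw0, hB _ _ _ N.zero_mem, hD] at this
        rw [← this]
        refine Finset.sum_congr rfl fun i _ => ?_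
        simp; ring
      have h2 : μ * cm x0 ∈ LinearMap.range cm := by
        rw [hMP.2]
        intro w hw
        have := hμ (mk 0 w 0)
        rw [hA, hA, hB _ _ _ hw0, hB _ _ _ hw, hD] at this
        rw [← this]
        refine Finset.sum_congr rfl fun i _ => ?_
        simp; ring
      have h3 : ∑ i, μ i = 0 := by
        have := hμ (mk 0 0 1)
        rw [hA, hA, hB _ _ _ hw0, hB _ _ _ N.zero_mem, hD] at this
        simpa using this
      obtain ⟨d, hd⟩ := hgood μ h2 h1
      ext i
      have : (n : ℂ) * d = 0 := by simpa [hd] using h3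
      have hn : (n : ℂ) ≠ 0 := by
        have := i.pos
        exact_mod_cast this.ne'
      rw [hd i]
      simpa [hn] using this)
  let T : (Fin n → ℂ) → (Fin n → ℂ) := fun y i => y i - (∑ k, y k) / n
  have hT : Continuous T := by fun_prop
  have hTl : T l = l := by
    ext i; simp [T, hl]
  rw [← hTl]
  refine closure_mono ?_ (image_closure_subset_closure_image hT ⟨l, hdense l, rfl⟩)
  rintro _ ⟨y, ⟨v, hv, hy⟩, rfl⟩
  have hsum : ∑ i, A v i * B v i = 0 := (hMP.1 (B v)).1 (hBN v) (A v) ⟨_, rfl⟩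
  have hTy : ∀ i, T y i = A v i * B v i := by
    intro i
    have hn : (n : ℂ) ≠ 0 := by
      have := i.pos
      exact_mod_cast this.ne'
    have : ∑ k, y k = n * D v := by
      simp only [← hy, Finset.sum_add_distrib, hsum]
      simp
    simp only [T, this]
    rw [← hy i]
    field_simp
    ring
  refine ⟨fun j => v (Sum.inl j), fun i => ?_, fun j => ?_⟩
  · rw [← hcm]; exact hv i
  · rw [← hBN v j]
    refine Finset.sum_congr rfl fun i _ => ?_
    rw [hTy, ← hcm]
    have h1 : A v i ≠ 0 := hv i
    show A v i * B v i * c i j / A v i = _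
    field_simp

theorem closure_of_critical_variety_over_origin
    (ℓ n : ℕ) (c : Fin n → Fin ℓ → ℂ)
    (hnz : ∀ i, c i ≠ 0)
    (hess : Submodule.span ℂ (Set.range c) = ⊤)
    (hirr : ArrIrreducible c)
    (Sig : Set ((Fin ℓ → ℂ) × (Fin n → ℂ)))
    (hSig : Sig = {p | (∀ i, (∑ j, c i j * p.1 j) ≠ 0) ∧
      ∀ j, (∑ i, p.2 i * c i j / (∑ j', c i j' * p.1 j')) = 0}) :
    closure Sig ∩ {p | p.1 = 0} =
      {p : (Fin ℓ → ℂ) × (Fin n → ℂ) | p.1 = 0 ∧ ∑ i, p.2 i = 0} := by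
  apply Set.Subset.antisymm
  · rintro ⟨x, l⟩ ⟨hcl, hx⟩
    refine ⟨hx, ?_⟩
    have hclosed : IsClosed {p : (Fin ℓ → ℂ) × (Fin n → ℂ) | ∑ i, p.2 i = 0} :=
      isClosed_eq (by fun_prop) continuous_const
    refine closure_minimal ?_ hclosed hcl
    intro p hp
    rw [hSig] at hp
    obtain ⟨h1, h2⟩ := hp
    have h3 : ∑ j, (∑ i, p.2 i * c i j / (∑ j', c i j' * p.1 j')) * p.1 j = 0 :=
      Finset.sum_eq_zero fun j _ => by rw [h2 j, zero_mul]
    show ∑ i, p.2 i = 0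
    rw [← h3]
    simp only [Finset.sum_mul]
    rw [Finset.sum_comm]
    refine Finset.sum_congr rfl fun i _ => ?_
    have h4 : ∀ j, p.2 i * c i j / (∑ j', c i j' * p.1 j') * p.1 j =
        (p.2 i / (∑ j', c i j' * p.1 j')) * (c i j * p.1 j) := fun j => by ring
    simp only [h4]
    rw [← Finset.mul_sum, div_mul_cancel₀ _ (h1 i)]
  · rintro ⟨x, l⟩ ⟨hx, hl⟩
    refine ⟨?_, hx⟩
    have hx' : x = 0 := hx
    subst hx'
    have hclosed : IsClosed {m : Fin n → ℂ | ((0 : Fin ℓ → ℂ), m) ∈ closure Sig} :=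
      isClosed_closure.preimage (by fun_prop)
    refine closure_minimal ?_ hclosed (arr_closure_proj c hnz hess hirr l hl)
    rintro m ⟨x, h1, h2⟩
    have hlim : Filter.Tendsto (fun t : ℂ => (t • x, m)) (nhdsWithin 0 {0}ᶜ)
        (nhds ((0 : Fin ℓ → ℂ), m)) := by
      have : Continuous (fun t : ℂ => (t • x, m)) := by fun_prop
      have h := this.tendsto 0
      rw [zero_smul] at h
      exact h.mono_left nhdsWithin_le_nhds
    refine mem_closure_of_tendsto hlim ?_
    filter_upwards [self_mem_nhdsWithin] with t ht
    have ht0 : t ≠ 0 := ht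
    have h3 : ∀ i, ∑ j, c i j * (t • x) j = t * ∑ j, c i j * x j := by
      intro i
      rw [Finset.mul_sum]
      exact Finset.sum_congr rfl fun j _ => by simp; ring
    rw [hSig]
    refine ⟨fun i => ?_, fun j => ?_⟩
    · show ∑ j, c i j * (t • x) j ≠ 0
      rw [h3]; exact mul_ne_zero ht0 (h1 i)
    · show (∑ i, m i * c i j / (∑ j', c i j' * (t • x) j')) = 0
      simp only [h3]
      have h4 : ∀ i, m i * c i j / (t * ∑ j', c i j' * x j') =
          t⁻¹ * (m i * c i j / (∑ j', c i j' * x j')) := fun i => by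
        rw [div_mul_eq_div_div_swap, div_eq_inv_mul]
      simp only [h4]
      rw [← Finset.mul_sum, h2 j, mul_zero]
end

section
/- The logarithmic ideal I(A) is a complete intersection if and only if the arrangement A is free. More precisely: if A is free, I(A) is generated by the ℓ homogeneous elements ⟨D_i, ω_a⟩ of degrees equal to the exponents of A; conversely, if I(A) can be generated by ℓ elements, then Der(A) is a free R-module. -/
open MvPolynomial Finset

/-- The `i`-th defining linear form, in `S = ℂ[a_1,…,a_n,x_1,…,x_ℓ]`
(variables `Sum.inl i = a_i`, `Sum.inr j = x_j`). -/
noncomputable def fS {ℓ n : ℕ} (c : Fin n → Fin ℓ → ℂ) (i : Fin n) :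
    MvPolynomial (Fin n ⊕ Fin ℓ) ℂ :=
  ∑ j, C (c i j) * X (Sum.inr j)

/-- The defining polynomial `Q = f_1 ⋯ f_n` of the arrangement, in `S`. -/
noncomputable def QS {ℓ n : ℕ} (c : Fin n → Fin ℓ → ℂ) : MvPolynomial (Fin n ⊕ Fin ℓ) ℂ :=
  ∏ i, fS c i

/-- `Q/f_i`. -/
noncomputable def Qdiv {ℓ n : ℕ} (c : Fin n → Fin ℓ → ℂ) (i : Fin n) :
    MvPolynomial (Fin n ⊕ Fin ℓ) ℂ :=
  ∏ k ∈ univ.erase i, fS c k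

/-- `Q·d_j = ∑_i a_i c_{ij} Q/f_i`, the numerator of the `j`-th coordinate of the
universal 1-form `ω_a = ∑_i a_i df_i/f_i`. -/
noncomputable def Qd {ℓ n : ℕ} (c : Fin n → Fin ℓ → ℂ) (j : Fin ℓ) :
    MvPolynomial (Fin n ⊕ Fin ℓ) ℂ :=
  ∑ i, X (Sum.inl i) * C (c i j) * Qdiv c i

/-- `θ = ∑_j θ_j ∂/∂x_j` (coefficients in `S`) is a logarithmic derivation: `θ(Q) ∈ (Q)`. -/
def IsLogDer {ℓ n : ℕ} (c : Fin n → Fin ℓ → ℂ)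
    (θ : Fin ℓ → MvPolynomial (Fin n ⊕ Fin ℓ) ℂ) : Prop :=
  (∑ j, θ j * pderiv (Sum.inr j) (QS c)) ∈ Ideal.span {QS c}

/-- `g = ⟨θ, ω_a⟩`, i.e. `Q·g = ∑_i a_i (Q/f_i) θ(f_i)`. -/
def PairsWith {ℓ n : ℕ} (c : Fin n → Fin ℓ → ℂ)
    (θ : Fin ℓ → MvPolynomial (Fin n ⊕ Fin ℓ) ℂ)
    (g : MvPolynomial (Fin n ⊕ Fin ℓ) ℂ) : Prop :=
  QS c * g = ∑ i, X (Sum.inl i) * Qdiv c i * (∑ j, θ j * pderiv (Sum.inr j) (fS c i))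

/-- The logarithmic ideal `I(A) = (⟨θ, ω_a⟩ : θ ∈ Der(A))  ⊆ S`. -/
noncomputable def Ilog {ℓ n : ℕ} (c : Fin n → Fin ℓ → ℂ) :
    Ideal (MvPolynomial (Fin n ⊕ Fin ℓ) ℂ) :=
  Ideal.span {g | ∃ θ, IsLogDer c θ ∧ PairsWith c θ g}

/-- The grading of `S` by degree in the `x`-variables. -/
noncomputable def xwt {ℓ n : ℕ} : (Fin n ⊕ Fin ℓ) → ℕ :=
  Sum.elim (fun _ => 0) (fun _ => 1)

/-- The module `Der(A)` of logarithmic derivations of the arrangement with defining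
polynomial `Q`, as a submodule of `(Fin ℓ → R)` (coordinates of `θ = ∑ θ_j ∂/∂x_j`). -/
noncomputable def DerArr (ℓ : ℕ) (Q : MvPolynomial (Fin ℓ) ℂ) :
    Submodule (MvPolynomial (Fin ℓ) ℂ) (Fin ℓ → MvPolynomial (Fin ℓ) ℂ) where
  carrier := {r | (∑ j, r j * pderiv j Q) ∈ Ideal.span {Q}}
  add_mem' := by
    intro a b ha hb
    have h : (∑ j, (a + b) j * pderiv j Q)
        = (∑ j, a j * pderiv j Q) + ∑ j, b j * pderiv j Q := by
      simp [add_mul, Finset.sum_add_distrib]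
    show (∑ j, (a + b) j * pderiv j Q) ∈ Ideal.span {Q}
    rw [h]
    exact Ideal.add_mem _ ha hb
  zero_mem' := by simp
  smul_mem' := by
    intro t a ha
    have h : (∑ j, (t • a) j * pderiv j Q) = t * ∑ j, a j * pderiv j Q := by
      simp [Finset.mul_sum, mul_assoc]
    show (∑ j, (t • a) j * pderiv j Q) ∈ Ideal.span {Q}
    rw [h]
    exact Ideal.mul_mem_left _ t ha

/-- The defining polynomial in `R = ℂ[x_1,…,x_ℓ]`. -/
noncomputable def Qx {ℓ n : ℕ} (c : Fin n → Fin ℓ → ℂ) : MvPolynomial (Fin ℓ) ℂ :=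
  ∏ i, ∑ j, C (c i j) * X j


noncomputable def fx {ℓ n : ℕ} (c : Fin n → Fin ℓ → ℂ) (i : Fin n) : MvPolynomial (Fin ℓ) ℂ :=
  ∑ j, C (c i j) * X j

noncomputable def qx {ℓ n : ℕ} (c : Fin n → Fin ℓ → ℂ) (i : Fin n) : MvPolynomial (Fin ℓ) ℂ :=
  ∏ k ∈ univ.erase i, fx c k

section aux
variable {ℓ n : ℕ} (c : Fin n → Fin ℓ → ℂ)

lemma fx_mul_qx (i : Fin n) : fx c i * qx c i = Qx c :=
  Finset.mul_prod_erase univ (fx c) (mem_univ i)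

lemma pderiv_fx (i : Fin n) (j : Fin ℓ) : pderiv j (fx c i) = C (c i j) := by
  classical
  simp [fx, pderiv_X, Pi.single_apply]

lemma fx_inj (v w : Fin ℓ → ℂ)
    (h : (∑ j, C (v j) * X j : MvPolynomial (Fin ℓ) ℂ) = ∑ j, C (w j) * X j) : v = w := by
  classical
  funext j
  have := congrArg (pderiv j) h
  simpa [pderiv_X, Pi.single_apply] using this

lemma fx_irred (hnz : ∀ i, c i ≠ 0) (i : Fin n) : Irreducible (fx c i) := by
  classical
  have h : fx c i = sumSMulX (Finsupp.equivFunOnFinite.symm (c i)) := by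
    rw [sumSMulX, Finsupp.linearCombination_apply, Finsupp.sum_fintype _ _ (by simp)]
    simp [fx, smul_eq_C_mul]
  obtain ⟨j, hj⟩ := Function.ne_iff.mp (hnz i)
  rw [h]
  apply irreducible_sumSMulX
  · exact ⟨j, by simpa using hj⟩
  · intro r hr
    have := hr j
    rw [isUnit_iff_ne_zero]
    rintro rfl
    exact hj (by simpa using this)

lemma fx_prime (hnz : ∀ i, c i ≠ 0) (i : Fin n) : Prime (fx c i) :=
  (fx_irred c hnz i).prime

lemma Qx_ne (hnz : ∀ i, c i ≠ 0) : Qx c ≠ 0 :=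
  Finset.prod_ne_zero_iff.mpr fun i _ => (fx_irred c hnz i).ne_zero

lemma fx_not_dvd (hnz : ∀ i, c i ≠ 0) (hprop : ∀ i k, i ≠ k → ∀ t : ℂ, c i ≠ t • c k)
    (i : Fin n) : ¬ fx c i ∣ qx c i := by
  intro h
  obtain ⟨k, hk, hd⟩ := (fx_prime c hnz i).exists_mem_finset_dvd h
  obtain ⟨u, hu⟩ := (fx_irred c hnz i).associated_of_dvd (fx_irred c hnz k) hd
  obtain ⟨r, -, hr⟩ := isUnit_iff_eq_C_of_isReduced.mp u.isUnit
  rw [hr] at hu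
  refine hprop k i (Finset.ne_of_mem_erase hk) r ?_
  apply fx_inj
  change fx c k = _
  rw [← hu, fx, Finset.sum_mul]
  refine Finset.sum_congr rfl fun j _ => ?_
  simp [C_mul]; ring

lemma der_dvd (hnz : ∀ i, c i ≠ 0) (hprop : ∀ i k, i ≠ k → ∀ t : ℂ, c i ≠ t • c k)
    (θ : Fin ℓ → MvPolynomial (Fin ℓ) ℂ) (hθ : θ ∈ DerArr ℓ (Qx c)) (i : Fin n) :
    fx c i ∣ ∑ j, θ j * C (c i j) := by
  have h : Qx c ∣ ∑ j, θ j * pderiv j (Qx c) := Ideal.mem_span_singleton.mp hθ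
  have h2 : ∑ j, θ j * pderiv j (Qx c) =
      (∑ j, θ j * C (c i j)) * qx c i + fx c i * ∑ j, θ j * pderiv j (qx c i) := by
    rw [Finset.sum_mul, Finset.mul_sum, ← Finset.sum_add_distrib]
    refine Finset.sum_congr rfl fun j _ => ?_
    rw [← fx_mul_qx c i, pderiv_mul, pderiv_fx]; ring
  have h3 : fx c i ∣ Qx c := ⟨_, (fx_mul_qx c i).symm⟩
  have h4 := h3.trans h
  rw [h2, dvd_add_left (dvd_mul_right _ _)] at h4
  exact ((fx_prime c hnz i).dvd_or_dvd h4).resolve_right (fx_not_dvd c hnz hprop i)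

lemma exists_P (hnz : ∀ i, c i ≠ 0) (hprop : ∀ i k, i ≠ k → ∀ t : ℂ, c i ≠ t • c k) :
    ∃ P : DerArr ℓ (Qx c) →ₗ[MvPolynomial (Fin ℓ) ℂ] (Fin n → MvPolynomial (Fin ℓ) ℂ),
      ∀ θ i, ∑ j, θ.1 j * C (c i j) = fx c i * P θ i := by
  choose P hP using fun (θ : DerArr ℓ (Qx c)) i => der_dvd c hnz hprop θ.1 θ.2 i
  refine ⟨{ toFun := P, map_add' := ?_, map_smul' := ?_ }, hP⟩
  · intro a b
    funext i
    apply mul_left_cancel₀ (fx_irred c hnz i).ne_zero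
    rw [← hP, Pi.add_apply, mul_add, ← hP, ← hP, ← Finset.sum_add_distrib]
    simp [add_mul]
  · intro r a
    funext i
    apply mul_left_cancel₀ (fx_irred c hnz i).ne_zero
    rw [← hP, RingHom.id_apply, Pi.smul_apply, smul_eq_mul, mul_left_comm, ← hP, Finset.mul_sum]
    simp [mul_assoc]

lemma P_inj (hess : Submodule.span ℂ (Set.range c) = ⊤)
    (P : DerArr ℓ (Qx c) →ₗ[MvPolynomial (Fin ℓ) ℂ] (Fin n → MvPolynomial (Fin ℓ) ℂ))
    (hP : ∀ θ i, ∑ j, θ.1 j * C (c i j) = fx c i * P θ i) : Function.Injective P := by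
  classical
  rw [← LinearMap.ker_eq_bot, LinearMap.ker_eq_bot']
  intro θ h0
  have h1 : ∀ v ∈ Submodule.span ℂ (Set.range c), ∑ j, θ.1 j * C (v j) = 0 := by
    intro v hv
    induction hv using Submodule.span_induction with
    | mem x hx => obtain ⟨i, rfl⟩ := hx; rw [hP, h0]; simp
    | zero => simp
    | add x y _ _ hx hy => simp [mul_add, Finset.sum_add_distrib, hx, hy]
    | smul a x _ hx =>
      have : ∑ j, θ.1 j * C ((a • x) j) = C a * ∑ j, θ.1 j * C (x j) := by
        rw [Finset.mul_sum]
        refine Finset.sum_congr rfl fun j _ => ?_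
        simp [C_mul]; ring
      rw [this, hx, mul_zero]
  ext1
  funext j
  have := h1 (Pi.single j 1) (by rw [hess]; trivial)
  simpa [Pi.single_apply, apply_ite] using this

lemma Q_smul_mem (v : Fin ℓ → MvPolynomial (Fin ℓ) ℂ) : Qx c • v ∈ DerArr ℓ (Qx c) := by
  change (∑ j, (Qx c • v) j * pderiv j (Qx c)) ∈ Ideal.span {Qx c}
  rw [Ideal.mem_span_singleton]
  exact Finset.dvd_sum fun j _ => by simp [mul_assoc]

end aux

/-- linear form attached to a vector of coefficients -/
noncomputable def Lam {R : Type*} [CommRing R] {n : ℕ} (u : Fin n → R) : MvPolynomial (Fin n) R :=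
  ∑ i, C (u i) * X i

lemma gen_of_ideal {R M : Type*} [CommRing R] [AddCommGroup M] [Module R M] {n ℓ : ℕ}
    (P : M →ₗ[R] (Fin n → R)) (hP : Function.Injective P)
    (g : Fin ℓ → MvPolynomial (Fin n) R)
    (hg : Ideal.span (Set.range fun θ => Lam (P θ)) = Ideal.span (Set.range g)) :
    ∃ h : Fin ℓ → M, Submodule.span R (Set.range h) = ⊤ := by
  classical
  have hlam : ∀ u : Fin n → R, constantCoeff (Lam u) = 0 := by intro u; simp [Lam]
  have hlin : ∀ (u : Fin n → R) i, constantCoeff (pderiv i (Lam u)) = u i := by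
    intro u i; simp [Lam, pderiv_X, Pi.single_apply, apply_ite]
  have key : ∀ a ∈ Ideal.span (Set.range fun θ => Lam (P θ)),
      constantCoeff a = 0 ∧ ∃ m : M, ∀ i, constantCoeff (pderiv i a) = P m i := by
    intro a ha
    induction ha using Submodule.span_induction with
    | mem x hx => obtain ⟨θ, rfl⟩ := hx; exact ⟨hlam _, θ, hlin _⟩
    | zero => exact ⟨by simp, 0, by simp⟩
    | add x y _ _ hx hy =>
      obtain ⟨hx, m, hm⟩ := hx
      obtain ⟨hy, m', hm'⟩ := hy
      exact ⟨by simp [hx, hy], m + m', by intro i; simp [hm, hm']⟩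
    | smul s x _ hx =>
      obtain ⟨hx, m, hm⟩ := hx
      refine ⟨by simp [hx], constantCoeff s • m, ?_⟩
      intro i
      rw [smul_eq_mul, pderiv_mul]
      simp [hx, hm]
  have hk : ∀ k, g k ∈ Ideal.span (Set.range fun θ => Lam (P θ)) := by
    intro k; rw [hg]; exact Ideal.subset_span ⟨k, rfl⟩
  choose h0 h hh using fun k => key _ (hk k)
  refine ⟨h, ?_⟩
  rw [eq_top_iff]
  intro θ _
  have hθ : Lam (P θ) ∈ Ideal.span (Set.range g) := by
    rw [← hg]; exact Ideal.subset_span ⟨θ, rfl⟩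
  obtain ⟨s, hs⟩ := (Submodule.mem_span_range_iff_exists_fun _).mp hθ
  rw [Submodule.mem_span_range_iff_exists_fun]
  refine ⟨fun k => constantCoeff (s k), hP ?_⟩
  funext i
  rw [← hlin (P θ) i, ← hs]
  simp only [map_sum, map_smul, Finset.sum_apply, smul_eq_mul, Pi.smul_apply, pderiv_mul, map_add,
    map_mul, h0, hh, mul_zero, zero_add]

lemma free_of_gen {R : Type*} [CommRing R] [IsDomain R] {ℓ : ℕ}
    (M : Submodule R (Fin ℓ → R)) (Q : R) (hQ : Q ≠ 0) (hM : ∀ v, Q • v ∈ M)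
    (h : Fin ℓ → M) (hh : Submodule.span R (Set.range h) = ⊤) : Module.Free R M := by
  classical
  let H : Matrix (Fin ℓ) (Fin ℓ) R := fun k => (h k).1
  have hB : ∀ i, ∃ b : Fin ℓ → R, ∑ k, b k • h k = ⟨Q • Pi.single i 1, hM _⟩ := by
    intro i
    apply (Submodule.mem_span_range_iff_exists_fun _).mp
    rw [hh]; trivial
  choose B hB using hB
  have hBH : Matrix.of B * H = Q • (1 : Matrix (Fin ℓ) (Fin ℓ) R) := by
    ext i j
    have := congrFun (congrArg Subtype.val (hB i)) j
    simp only [AddSubmonoidClass.coe_finsetSum, Submodule.coe_smul, Finset.sum_apply,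
      Pi.smul_apply, smul_eq_mul] at this
    rw [Matrix.mul_apply]
    simp only [Matrix.of_apply, Matrix.smul_apply, Matrix.one_apply, H, smul_eq_mul]
    rw [this, Pi.single_apply]
    simp [eq_comm]
  have hdet : H.det ≠ 0 := by
    intro h0
    have := congrArg Matrix.det hBH
    rw [Matrix.det_mul, h0, mul_zero, Matrix.det_smul, Matrix.det_one, mul_one] at this
    exact pow_ne_zero _ hQ this.symm
  have hli := Matrix.linearIndependent_rows_of_det_ne_zero hdet
  have hli' : LinearIndependent R h := LinearIndependent.of_comp M.subtype hli
  exact Module.Free.of_basis (Module.Basis.mk hli' hh.ge)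

lemma basis_of_free {R : Type*} [CommRing R] [IsDomain R] [IsNoetherianRing R] {ℓ : ℕ}
    (M : Submodule R (Fin ℓ → R)) (Q : R) (hQ : Q ≠ 0) (hM : ∀ v, Q • v ∈ M)
    [Module.Free R M] : Nonempty (Module.Basis (Fin ℓ) R M) := by
  have h1 : Module.finrank R M ≤ ℓ := by
    simpa using LinearMap.finrank_le_finrank_of_injective (f := M.subtype) M.injective_subtype
  have h2 : ℓ ≤ Module.finrank R M := by
    let f : (Fin ℓ → R) →ₗ[R] M := (LinearMap.lsmul R (Fin ℓ → R) Q).codRestrict M hM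
    have hf : Function.Injective f := by
      intro v w hvw
      have := congrArg Subtype.val hvw
      funext j
      exact mul_left_cancel₀ hQ (congrFun this j)
    simpa using LinearMap.finrank_le_finrank_of_injective hf
  exact ⟨Module.finBasisOfFinrankEq R M (le_antisymm h1 h2)⟩

lemma ideal_of_basis {R M : Type*} [CommRing R] [AddCommGroup M] [Module R M] {n ℓ : ℕ}
    (P : M →ₗ[R] (Fin n → R)) (b : Module.Basis (Fin ℓ) R M) :
    Ideal.span (Set.range fun θ => Lam (P θ)) = Ideal.span (Set.range fun k => Lam (P (b k))) := by
  apply le_antisymm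
  · rw [Ideal.span_le]
    rintro _ ⟨θ, rfl⟩
    have : Lam (P θ) = ∑ k, C (b.repr θ k) * Lam (P (b k)) := by
      conv_lhs => rw [← b.sum_repr θ]
      simp only [Lam, map_sum, map_smul, Finset.sum_apply, Pi.smul_apply, smul_eq_mul, C_mul,
        Finset.sum_mul, Finset.mul_sum]
      rw [Finset.sum_comm]
      simp only [mul_assoc]
    change Lam (P θ) ∈ _
    rw [this]
    exact Ideal.sum_mem _ fun k _ => Ideal.mul_mem_left _ _ (Ideal.subset_span ⟨k, rfl⟩)
  · apply Ideal.span_mono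
    rintro _ ⟨k, rfl⟩
    exact ⟨b k, rfl⟩

section trans
variable {ℓ n : ℕ} (c : Fin n → Fin ℓ → ℂ)

lemma fS_eq (i : Fin n) : fS c i = rename Sum.inr (fx c i) := by simp [fS, fx]

lemma QS_eq : QS c = rename Sum.inr (Qx c) := by
  simp [QS, Qx, fS]

lemma Qdiv_eq (i : Fin n) : Qdiv c i = rename Sum.inr (qx c i) := by
  simp [Qdiv, qx, fS_eq]

lemma e_rename (p : MvPolynomial (Fin ℓ) ℂ) :
    sumAlgEquiv ℂ (Fin n) (Fin ℓ) (rename Sum.inr p) = C p :=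
  DFunLike.congr_fun (sumAlgEquiv_comp_rename_inr (R := ℂ) (S₁ := Fin n) (S₂ := Fin ℓ)) p

lemma isLogDer_iff (θ : Fin ℓ → MvPolynomial (Fin n ⊕ Fin ℓ) ℂ) :
    IsLogDer c θ ↔ C (Qx c) ∣
      ∑ j, sumAlgEquiv ℂ (Fin n) (Fin ℓ) (θ j) * C (pderiv j (Qx c)) := by
  rw [IsLogDer, Ideal.mem_span_singleton, ← map_dvd_iff (sumAlgEquiv ℂ (Fin n) (Fin ℓ))]
  simp only [QS_eq, map_sum, map_mul, pderiv_rename Sum.inr_injective, e_rename]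

lemma pairsWith_iff (θ : Fin ℓ → MvPolynomial (Fin n ⊕ Fin ℓ) ℂ)
    (g : MvPolynomial (Fin n ⊕ Fin ℓ) ℂ) :
    PairsWith c θ g ↔ C (Qx c) * sumAlgEquiv ℂ (Fin n) (Fin ℓ) g =
      ∑ i, X i * C (qx c i) * ∑ j, sumAlgEquiv ℂ (Fin n) (Fin ℓ) (θ j) * C (C (c i j)) := by
  rw [PairsWith, ← (sumAlgEquiv ℂ (Fin n) (Fin ℓ)).injective.eq_iff]
  simp only [QS_eq, fS_eq, Qdiv_eq, map_sum, map_mul, pderiv_rename Sum.inr_injective, e_rename,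
    pderiv_fx, sumAlgEquiv_X_inl]

lemma Lam_pair 
    (P : DerArr ℓ (Qx c) →ₗ[MvPolynomial (Fin ℓ) ℂ] (Fin n → MvPolynomial (Fin ℓ) ℂ))
    (hP : ∀ θ i, ∑ j, θ.1 j * C (c i j) = fx c i * P θ i) (θ : DerArr ℓ (Qx c)) :
    C (Qx c) * Lam (P θ) =
      ∑ i, X i * C (qx c i) * ∑ j, C (θ.1 j) * C (C (c i j)) := by
  rw [Lam, Finset.mul_sum]
  refine Finset.sum_congr rfl fun i _ => ?_
  have := congrArg (C (σ := Fin n)) (hP θ i)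
  simp only [map_sum, map_mul] at this
  have h2 := congrArg (C (σ := Fin n)) (fx_mul_qx c i)
  rw [C_mul] at h2
  rw [this, ← h2]
  ring

lemma map_Ilog (hnz : ∀ i, c i ≠ 0)
    (P : DerArr ℓ (Qx c) →ₗ[MvPolynomial (Fin ℓ) ℂ] (Fin n → MvPolynomial (Fin ℓ) ℂ))
    (hP : ∀ θ i, ∑ j, θ.1 j * C (c i j) = fx c i * P θ i) :
    (Ilog c).map (sumAlgEquiv ℂ (Fin n) (Fin ℓ)) = Ideal.span (Set.range fun θ => Lam (P θ)) := by
  classical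
  rw [Ilog, Ideal.map_span]
  apply le_antisymm
  · rw [Ideal.span_le]
    rintro _ ⟨g, ⟨θ, hθ, hg⟩, rfl⟩
    rw [isLogDer_iff] at hθ
    rw [pairsWith_iff] at hg
    set t : Fin ℓ → MvPolynomial (Fin n) (MvPolynomial (Fin ℓ) ℂ) :=
      fun j => sumAlgEquiv ℂ (Fin n) (Fin ℓ) (θ j) with ht
    have hmem : ∀ m : Fin n →₀ ℕ, (fun j => coeff m (t j)) ∈ DerArr ℓ (Qx c) := by
      intro m
      obtain ⟨s, hs⟩ := hθ
      change (∑ j, coeff m (t j) * pderiv j (Qx c)) ∈ Ideal.span {Qx c}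
      rw [Ideal.mem_span_singleton]
      refine ⟨coeff m s, ?_⟩
      have := congrArg (coeff m) hs
      rw [coeff_sum, coeff_C_mul] at this
      rw [← this]
      refine Finset.sum_congr rfl fun j _ => ?_
      rw [mul_comm _ (C _), coeff_C_mul, mul_comm]
    let T : Finset (Fin n →₀ ℕ) := univ.biUnion fun j => (t j).support
    have hT : ∀ j, t j = ∑ m ∈ T, monomial m 1 * C (coeff m (t j)) := by
      intro j
      conv_lhs => rw [(t j).as_sum]
      simp only [← monomial_zero', monomial_mul, add_zero, one_mul]
      apply Finset.sum_subset
      · exact Finset.subset_biUnion_of_mem (fun j => (t j).support) (mem_univ j)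
      · intro m _ hm
        rw [notMem_support_iff.mp hm, monomial_zero]
    have hgs : sumAlgEquiv ℂ (Fin n) (Fin ℓ) g =
        ∑ m ∈ T, monomial m 1 * Lam (P ⟨_, hmem m⟩) := by
      have hC : (C (Qx c) : MvPolynomial (Fin n) (MvPolynomial (Fin ℓ) ℂ)) ≠ 0 := by
        simpa using Qx_ne c hnz
      apply mul_left_cancel₀ hC
      rw [hg, Finset.mul_sum]
      have h1 : ∀ m ∈ T, C (Qx c) * (monomial m 1 * Lam (P ⟨_, hmem m⟩)) =
          monomial m 1 * ∑ i, X i * C (qx c i) * ∑ j, C (coeff m (t j)) * C (C (c i j)) := by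
        intro m _
        rw [mul_left_comm, Lam_pair c P hP]
      rw [Finset.sum_congr rfl h1]
      simp only [Finset.mul_sum]
      rw [Finset.sum_comm (s := T)]
      refine Finset.sum_congr rfl fun i _ => ?_
      rw [Finset.sum_comm (s := T)]
      refine Finset.sum_congr rfl fun j _ => ?_
      change _ * (t j * _) = _
      conv_lhs => rw [hT j]
      rw [Finset.sum_mul, Finset.mul_sum]
      refine Finset.sum_congr rfl fun m _ => ?_
      ring
    change sumAlgEquiv ℂ (Fin n) (Fin ℓ) g ∈ _
    rw [hgs]
    exact Ideal.sum_mem _ fun m _ => Ideal.mul_mem_left _ _ (Ideal.subset_span ⟨_, rfl⟩)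
  · apply Ideal.span_mono
    rintro _ ⟨θ, rfl⟩
    refine ⟨(sumAlgEquiv ℂ (Fin n) (Fin ℓ)).symm (Lam (P θ)),
      ⟨fun j => rename Sum.inr (θ.1 j), ?_, ?_⟩, by simp⟩
    · rw [isLogDer_iff]
      simp only [e_rename, ← C_mul, ← map_sum]
      exact map_dvd _ (Ideal.mem_span_singleton.mp θ.2)
    · rw [pairsWith_iff]
      simp only [e_rename, AlgEquiv.apply_symm_apply]
      exact Lam_pair c P hP θ

end trans

/-!
STATEMENT 8: The logarithmic ideal `I(A)` is a complete intersection if and only if the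
arrangement `A` is free.  Since `V(I(A))` always has codimension `ℓ`, being a complete
intersection is equivalent to `I(A)` being generated by `ℓ` elements; and `A` is free iff
`Der(A)` is a free `R`-module.
-/
theorem logarithmic_ideal_complete_intersection_iff_free
    (ℓ n : ℕ) (c : Fin n → Fin ℓ → ℂ)
    (hnz : ∀ i, c i ≠ 0)
    (hprop : ∀ i k, i ≠ k → ∀ t : ℂ, c i ≠ t • c k)
    (hess : Submodule.span ℂ (Set.range c) = ⊤) :
    (∃ g : Fin ℓ → MvPolynomial (Fin n ⊕ Fin ℓ) ℂ, Ilog c = Ideal.span (Set.range g)) ↔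
      Module.Free (MvPolynomial (Fin ℓ) ℂ) (DerArr ℓ (Qx c)) := by
  obtain ⟨P, hP⟩ := exists_P c hnz hprop
  have hPi := P_inj c hess P hP
  have hI := map_Ilog c hnz P hP
  constructor
  · rintro ⟨g, hg⟩
    rw [hg, Ideal.map_span, ← Set.range_comp] at hI
    obtain ⟨h, hh⟩ := gen_of_ideal P hPi _ hI.symm
    exact free_of_gen _ (Qx c) (Qx_ne c hnz) (Q_smul_mem c) h hh
  · intro hfree
    obtain ⟨b⟩ := basis_of_free (DerArr ℓ (Qx c)) (Qx c) (Qx_ne c hnz) (Q_smul_mem c)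
    rw [ideal_of_basis P b] at hI
    refine ⟨fun k => (sumAlgEquiv ℂ (Fin n) (Fin ℓ)).symm (Lam (P (b k))), ?_⟩
    have h2 := congrArg (Ideal.map (sumAlgEquiv ℂ (Fin n) (Fin ℓ)).symm) hI
    rw [Ideal.map_span, ← Set.range_comp] at h2
    refine Eq.trans ?_ h2
    refine le_antisymm (fun x hx => ?_) (Ideal.map_le_iff_le_comap.mpr
      (Ideal.map_le_iff_le_comap.mpr fun x hx => ?_))
    · have := Ideal.mem_map_of_mem (sumAlgEquiv ℂ (Fin n) (Fin ℓ)).symm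
        (Ideal.mem_map_of_mem (sumAlgEquiv ℂ (Fin n) (Fin ℓ)) hx)
      rwa [AlgEquiv.symm_apply_apply] at this
    · rw [Ideal.mem_comap, Ideal.mem_comap, AlgEquiv.symm_apply_apply]
      exact hx
end
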